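/- Let (M,g) be a second-order symmetric Brinkmann spacetime, with metric written in a Brinkmann chart {u,v,x^i} as ds² = -2du(dv + H du + W_i dx^i) + g_{ij} dx^i dx^j, where H, W_i, g_{ij} are independent of v. Then, for every Brinkmann chart, each leaf of the foliation by the submanifolds {u = const, v = const}, equipped with the induced Riemannian metric g_{ij}(u,·), is a locally symmetric Riemannian manifold. -/

import Mathlib

/-!
Core framework: coordinate tensor calculus on `ℝⁿ` (partial derivatives, Christoffel
symbols, Riemann curvature, iterated covariant derivatives `∇ʳR`), and a notion of
pseudo-Riemannian manifold given by an atlas of metric charts whose transition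
functions are smooth isometries.
-/

noncomputable section

open Matrix Set

/-- Partial derivative in the `i`-th coordinate direction. -/
def pd {n : ℕ} (i : Fin n) (f : (Fin n → ℝ) → ℝ) (x : Fin n → ℝ) : ℝ :=
  fderiv ℝ f x (Pi.single i 1)

/-- A metric in coordinates: a matrix-valued function on (an open subset of) `ℝⁿ`. -/
abbrev MetricMat (n : ℕ) := (Fin n → ℝ) → Matrix (Fin n) (Fin n) ℝ

/-- Christoffel symbols `Γ^k_{ij}` of a coordinate metric. -/
def christoffel {n : ℕ} (g : MetricMat n) (x : Fin n → ℝ) (k i j : Fin n) : ℝ :=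
  (1 / 2) * ∑ l, (g x)⁻¹ k l *
    (pd i (fun y => g y l j) x + pd j (fun y => g y l i) x - pd l (fun y => g y i j) x)

/-- Curvature tensor `R^l_{kij}` (1,3) of a coordinate metric. -/
def curvUp {n : ℕ} (g : MetricMat n) (x : Fin n → ℝ) (l k i j : Fin n) : ℝ :=
  pd i (fun y => christoffel g y l j k) x - pd j (fun y => christoffel g y l i k) x
    + ∑ m, christoffel g x l i m * christoffel g x m j k
    - ∑ m, christoffel g x l j m * christoffel g x m i k

/-- Covariant tensor fields of valence `s` in coordinates. -/
abbrev TensorField (n s : ℕ) := (Fin n → ℝ) → (Fin s → Fin n) → ℝ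

/-- The (0,4) Riemann curvature tensor `R_{lkij} = g_{lm} R^m_{kij}`. -/
def riemann {n : ℕ} (g : MetricMat n) : TensorField n 4 := fun x idx =>
  ∑ m, g x (idx 0) m * curvUp g x m (idx 1) (idx 2) (idx 3)

/-- The Ricci tensor `R_{ij} = R^m_{imj}`. -/
def ricci {n : ℕ} (g : MetricMat n) (x : Fin n → ℝ) (i j : Fin n) : ℝ :=
  ∑ m, curvUp g x m i m j

/-- Covariant derivative of a covariant tensor field; the new (derivative) index is slot `0`. -/
def covDeriv {n s : ℕ} (g : MetricMat n) (T : TensorField n s) : TensorField n (s + 1) :=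
  fun x idx =>
    pd (idx 0) (fun y => T y fun a => idx a.succ) x
      - ∑ a : Fin s, ∑ e, christoffel g x e (idx 0) (idx a.succ)
          * T x (Function.update (fun b : Fin s => idx b.succ) a e)

/-- Iterated covariant derivative `∇ʳ R` of the curvature tensor. -/
def nablaR {n : ℕ} (g : MetricMat n) : (r : ℕ) → TensorField n (4 + r)
  | 0 => riemann g
  | r + 1 => covDeriv g (nablaR g r)

/-- `∇ʳ R = 0` on `U` (`r`-th symmetry in coordinates). -/
def RthSymmetricOn {n : ℕ} (g : MetricMat n) (U : Set (Fin n → ℝ)) (r : ℕ) : Prop :=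
  ∀ x ∈ U, ∀ idx, nablaR g r x idx = 0

/-- Vanishing curvature (flatness) on `U`. -/
def FlatOn {n : ℕ} (g : MetricMat n) (U : Set (Fin n → ℝ)) : Prop :=
  ∀ x ∈ U, ∀ idx, riemann g x idx = 0

/-- A symmetric matrix is of Lorentzian signature `(-,+,…,+)` iff it is congruent to
`diag(-1,1,…,1)`. -/
def IsLorentzMat {n : ℕ} (A : Matrix (Fin n) (Fin n) ℝ) : Prop :=
  ∃ P : Matrix (Fin n) (Fin n) ℝ, IsUnit P.det ∧
    Pᵀ * A * P = Matrix.diagonal fun i : Fin n => if (i : ℕ) = 0 then (-1 : ℝ) else 1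

/-- `τ` is smooth on `S` and pulls the metric `g₂` back to the metric `g₁` there. -/
def IsPullbackIsometry {n m : ℕ} (g₁ : MetricMat n) (g₂ : MetricMat m)
    (τ : (Fin n → ℝ) → Fin m → ℝ) (S : Set (Fin n → ℝ)) : Prop :=
  (∀ a : Fin m, ContDiffOn ℝ (⊤ : ℕ∞) (fun y => τ y a) S) ∧
  ∀ x ∈ S, ∀ i j : Fin n,
    g₁ x i j = ∑ a, ∑ b, g₂ (τ x) a b * pd i (fun y => τ y a) x * pd j (fun y => τ y b) x

/-- A metric chart on a topological space `M`: a homeomorphism of an open set of `M` onto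
an open set of `ℝⁿ`, together with the coordinate expression of the metric tensor. -/
structure MetricChart (n : ℕ) (M : Type) [TopologicalSpace M] where
  dom : Set M
  open_dom : IsOpen dom
  φ : M → Fin n → ℝ
  ψ : (Fin n → ℝ) → M
  ran : Set (Fin n → ℝ)
  open_ran : IsOpen ran
  maps_to : ∀ p ∈ dom, φ p ∈ ran
  maps_from : ∀ x ∈ ran, ψ x ∈ dom
  left_inv : ∀ p ∈ dom, ψ (φ p) = p
  right_inv : ∀ x ∈ ran, φ (ψ x) = x
  cont_phi : ContinuousOn φ dom
  cont_psi : ContinuousOn ψ ran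
  g : MetricMat n
  smooth_g : ∀ a b : Fin n, ContDiffOn ℝ (⊤ : ℕ∞) (fun x => g x a b) ran
  symm_g : ∀ x ∈ ran, (g x).IsSymm
  nondeg_g : ∀ x ∈ ran, IsUnit (g x).det

/-- An `n`-dimensional pseudo-Riemannian manifold: a topological space covered by metric
charts whose transition functions are (smooth) isometries for the chart metrics. -/
structure PRManifold (n : ℕ) where
  M : Type
  top : TopologicalSpace M
  chartAt : M → @MetricChart n M top
  mem_chart : ∀ p : M, p ∈ (chartAt p).dom
  compatible : ∀ p q : M,
    IsPullbackIsometry (chartAt p).g (chartAt q).g ((chartAt q).φ ∘ (chartAt p).ψ)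
      ((chartAt p).φ '' ((chartAt p).dom ∩ (chartAt q).dom))

attribute [instance] PRManifold.top

namespace PRManifold

variable {n : ℕ}

/-- The metric is Lorentzian, of signature `(-,+,…,+)`. -/
def IsLorentzian (X : PRManifold n) : Prop :=
  ∀ p : X.M, ∀ x ∈ (X.chartAt p).ran, IsLorentzMat ((X.chartAt p).g x)

/-- The metric is Riemannian (positive definite). -/
def IsRiemannian (X : PRManifold n) : Prop :=
  ∀ p : X.M, ∀ x ∈ (X.chartAt p).ran, ((X.chartAt p).g x).PosDef

/-- Connectedness of the underlying space. -/
def Conn (X : PRManifold n) : Prop := ConnectedSpace X.M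

/-- Simple connectedness of the underlying space. -/
def SimplyConn (X : PRManifold n) : Prop := SimplyConnectedSpace X.M

/-- `∇ʳ R = 0` (in every chart). -/
def RthSymmetric (X : PRManifold n) (r : ℕ) : Prop :=
  ∀ p : X.M, RthSymmetricOn (X.chartAt p).g (X.chartAt p).ran r

/-- `∇ʳ R = 0` but `∇^{r-1} R ≠ 0`. -/
def ProperRthSymmetric (X : PRManifold n) (r : ℕ) : Prop :=
  X.RthSymmetric r ∧ ¬ X.RthSymmetric (r - 1)

/-- The curvature tensor vanishes identically. -/
def Flat (X : PRManifold n) : Prop :=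
  ∀ p : X.M, FlatOn (X.chartAt p).g (X.chartAt p).ran

/-- The Ricci tensor vanishes identically. -/
def RicciFlat (X : PRManifold n) : Prop :=
  ∀ p : X.M, ∀ x ∈ (X.chartAt p).ran, ∀ i j, ricci (X.chartAt p).g x i j = 0

end PRManifold

/-- A curve `c` (written in coordinates) is a geodesic of `g` on the parameter set `I`:
its components are twice differentiable and satisfy the geodesic equations. -/
def IsGeodesicCurve {n : ℕ} (g : MetricMat n) (I : Set ℝ) (c : ℝ → Fin n → ℝ) : Prop :=
  ∀ t ∈ I, ∀ k : Fin n,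
    DifferentiableAt ℝ (fun s => c s k) t ∧
    DifferentiableAt ℝ (deriv fun s => c s k) t ∧
    deriv (deriv fun s => c s k) t
      + ∑ i, ∑ j, christoffel g (c t) k i j * deriv (fun s => c s i) t
          * deriv (fun s => c s j) t = 0

namespace PRManifold

variable {n : ℕ}

/-- `γ` is a geodesic of `X` on the parameter set `I`: around each parameter it lies in a
chart and its coordinate expression solves the geodesic equations there. -/
def IsGeodesic (X : PRManifold n) (I : Set ℝ) (γ : ℝ → X.M) : Prop :=
  ∀ t ∈ I, ∃ p : X.M, ∃ ε > (0 : ℝ),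
    (∀ s ∈ I ∩ Set.Ioo (t - ε) (t + ε), γ s ∈ (X.chartAt p).dom) ∧
    IsGeodesicCurve (X.chartAt p).g (I ∩ Set.Ioo (t - ε) (t + ε))
      (fun s => (X.chartAt p).φ (γ s))

/-- Geodesic completeness: every (nontrivial) geodesic defined on an open interval
extends to a geodesic defined on all of `ℝ`. -/
def GeodesicallyComplete (X : PRManifold n) : Prop :=
  ∀ (a b : ℝ) (γ : ℝ → X.M), (Set.Ioo a b).Nonempty → X.IsGeodesic (Set.Ioo a b) γ →
    ∃ γ' : ℝ → X.M, X.IsGeodesic Set.univ γ' ∧ ∀ t ∈ Set.Ioo a b, γ' t = γ t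

end PRManifold

/-- First block of coordinates of a product. -/
def split1 {n₁ n₂ : ℕ} (x : Fin (n₁ + n₂) → ℝ) : Fin n₁ → ℝ := fun i => x (Fin.castAdd n₂ i)

/-- Second block of coordinates of a product. -/
def split2 {n₁ n₂ : ℕ} (x : Fin (n₁ + n₂) → ℝ) : Fin n₂ → ℝ := fun j => x (Fin.natAdd n₁ j)

/-- The direct-product (block diagonal) metric `g₁ ⊕ g₂` in coordinates. -/
def prodMetricMat {n₁ n₂ : ℕ} (G₁ : MetricMat n₁) (G₂ : MetricMat n₂) :
    MetricMat (n₁ + n₂) := fun x =>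
  (Matrix.fromBlocks (G₁ (split1 x)) 0 0 (G₂ (split2 x))).submatrix
    finSumFinEquiv.symm finSumFinEquiv.symm

/-- The (generalized Cahen–Wallach / plane-wave) metric
`g = -2du(dv + P_{ij}(u)xⁱxʲ du) + δ_{ij} dxⁱ dxʲ` on `ℝ^{e+2}`,
with coordinates `x 0 = u`, `x 1 = v` and spatial coordinates `x i.succ.succ`. -/
def cwMetric (e : ℕ) (P : ℝ → Matrix (Fin e) (Fin e) ℝ) : MetricMat (e + 2) := fun x k l =>
  (if k = 0 ∧ l = 0 then (-2) * ∑ i, ∑ j, P (x 0) i j * x i.succ.succ * x j.succ.succ else 0)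
  + (if (k = 0 ∧ l = 1) ∨ (k = 1 ∧ l = 0) then -1 else 0)
  + (if k = l ∧ 2 ≤ (k : ℕ) then 1 else 0)

/-- The Brinkmann metric `ds² = -2du(dv + H du + Wᵢ dxⁱ) + g_{ij} dxⁱ dxʲ` on `ℝ^{d+2}`,
with coordinates `x 0 = u`, `x 1 = v` and spatial coordinates `x i.succ.succ`. -/
def brinkmannMat (d : ℕ) (H : (Fin (d + 2) → ℝ) → ℝ) (W : Fin d → (Fin (d + 2) → ℝ) → ℝ)
    (gs : (Fin (d + 2) → ℝ) → Matrix (Fin d) (Fin d) ℝ) : MetricMat (d + 2) := fun x k l =>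
  (if k = 0 ∧ l = 0 then (-2) * H x else 0)
  + (if (k = 0 ∧ l = 1) ∨ (k = 1 ∧ l = 0) then -1 else 0)
  + (if k = 0 then ∑ i : Fin d, if l = i.succ.succ then -(W i x) else 0 else 0)
  + (if l = 0 then ∑ i : Fin d, if k = i.succ.succ then -(W i x) else 0 else 0)
  + ∑ i : Fin d, ∑ j : Fin d, if k = i.succ.succ ∧ l = j.succ.succ then gs x i j else 0

/-- A function on `ℝ^{d+2}` is independent of the coordinate `v = x 1`. -/
def vIndep {d : ℕ} {α : Type*} (f : (Fin (d + 2) → ℝ) → α) : Prop :=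
  ∀ x t, f (Function.update x (1 : Fin (d + 2)) t) = f x

/-- The point of `ℝ^{d+2}` with `u`, `v` and spatial coordinates `u`, `v`, `y`. -/
def emb (d : ℕ) (u v : ℝ) (y : Fin d → ℝ) : Fin (d + 2) → ℝ :=
  Fin.cons u (Fin.cons v y)
-- extension layer (appended to core for testing)
namespace PRManifold

variable {n : ℕ}

/-- A self-map of `Y` is a (global) isometry: it is a homeomorphism and, read in the
charts, it pulls the metric back to the metric. -/
def IsAutoIsometry (Y : PRManifold n) (σ : Y.M → Y.M) : Prop :=
  Function.Bijective σ ∧ Continuous σ ∧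
    ∀ q : Y.M, ∃ S, IsOpen S ∧ (Y.chartAt q).φ q ∈ S ∧ S ⊆ (Y.chartAt q).ran ∧
      (∀ x ∈ S, σ ((Y.chartAt q).ψ x) ∈ (Y.chartAt (σ q)).dom) ∧
      IsPullbackIsometry (Y.chartAt q).g (Y.chartAt (σ q)).g
        (fun x => (Y.chartAt (σ q)).φ (σ ((Y.chartAt q).ψ x))) S

/-- `Y` is a (globally) symmetric space: the geodesic symmetry at every point extends to
a global isometry, i.e. every point is an isolated fixed point of a global isometry whose
differential there is `-id` (in chart coordinates). -/
def IsSymmetricSpace (Y : PRManifold n) : Prop :=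
  ∀ q : Y.M, ∃ σ : Y.M → Y.M, Y.IsAutoIsometry σ ∧ σ q = q ∧
    ∀ a i : Fin n,
      pd i (fun x => (Y.chartAt (σ q)).φ (σ ((Y.chartAt q).ψ x)) a) ((Y.chartAt q).φ q)
        = -(if i = a then 1 else 0)

/-- The metric of `X` is real-analytic: around every point there are coordinates in which
the metric components are real-analytic functions. -/
def AnalyticMetric (X : PRManifold n) : Prop :=
  ∀ p : X.M, ∃ S, IsOpen S ∧ (X.chartAt p).φ p ∈ S ∧ S ⊆ (X.chartAt p).ran ∧
    ∃ (τ : (Fin n → ℝ) → Fin n → ℝ) (G : MetricMat n),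
      Set.InjOn τ S ∧ (∀ a b : Fin n, AnalyticOnNhd ℝ (fun y => G y a b) (τ '' S)) ∧
      IsPullbackIsometry (X.chartAt p).g G τ S

end PRManifold

/-- `Z` is globally isometric to the direct product `X × Y` (with the product metric):
there is a bijection which, read in charts, is an isometry onto the product. -/
def GloballyIsometricToProd {n₀ n₁ n₂ : ℕ} (Z : PRManifold n₀)
    (X : PRManifold n₁) (Y : PRManifold n₂) : Prop :=
  ∃ F : Z.M → X.M × Y.M, Function.Bijective F ∧
    ∀ p : Z.M, ∃ S, IsOpen S ∧ (Z.chartAt p).φ p ∈ S ∧ S ⊆ (Z.chartAt p).ran ∧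
      (∀ x ∈ S, (F ((Z.chartAt p).ψ x)).1 ∈ (X.chartAt (F p).1).dom
        ∧ (F ((Z.chartAt p).ψ x)).2 ∈ (Y.chartAt (F p).2).dom) ∧
      IsPullbackIsometry (Z.chartAt p).g
        (prodMetricMat (X.chartAt (F p).1).g (Y.chartAt (F p).2).g)
        (fun x => Fin.append ((X.chartAt (F p).1).φ (F ((Z.chartAt p).ψ x)).1)
          ((Y.chartAt (F p).2).φ (F ((Z.chartAt p).ψ x)).2)) S

/-- `X` is globally isometric to the direct product of the coordinate spacetime
`(ℝ^{e+2}, Gcw)` and `Y` (with the product metric). -/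
def GloballyIsometricToCWProd {n e m : ℕ} (X : PRManifold n) (Gcw : MetricMat (e + 2))
    (Y : PRManifold m) : Prop :=
  ∃ F : X.M → (Fin (e + 2) → ℝ) × Y.M, Function.Bijective F ∧
    ∀ p : X.M, ∃ S, IsOpen S ∧ (X.chartAt p).φ p ∈ S ∧ S ⊆ (X.chartAt p).ran ∧
      (∀ x ∈ S, (F ((X.chartAt p).ψ x)).2 ∈ (Y.chartAt (F p).2).dom) ∧
      IsPullbackIsometry (X.chartAt p).g (prodMetricMat Gcw (Y.chartAt (F p).2).g)
        (fun x => Fin.append (F ((X.chartAt p).ψ x)).1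
          ((Y.chartAt (F p).2).φ (F ((X.chartAt p).ψ x)).2)) S

/-- `X` is locally isometric to the direct product of the coordinate spacetime
`(ℝ^{e+2}, Gcw)` and `Y`: every point has a neighbourhood that maps isometrically into
the product. -/
def LocallyIsometricToCWProd {n e m : ℕ} (X : PRManifold n) (Gcw : MetricMat (e + 2))
    (Y : PRManifold m) : Prop :=
  ∀ p : X.M, ∃ q : Y.M, ∃ S, IsOpen S ∧ (X.chartAt p).φ p ∈ S ∧ S ⊆ (X.chartAt p).ran ∧
    ∃ τ : (Fin n → ℝ) → Fin ((e + 2) + m) → ℝ,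
      (∀ x ∈ S, split2 (n₁ := e + 2) (τ x) ∈ (Y.chartAt q).ran) ∧
      IsPullbackIsometry (X.chartAt p).g (prodMetricMat Gcw (Y.chartAt q).g) τ S

/-- An identification of `Σ i, Fin (m i)` with `Fin (∑ i, m i)`. -/
def sigmaFinEquiv {k : ℕ} (m : Fin k → ℕ) : (Σ i : Fin k, Fin (m i)) ≃ Fin (∑ i, m i) :=
  (Fintype.equivFin _).trans (finCongr (by simp))

/-- The `i`-th block of coordinates in `ℝ^{∑ mdim}`. -/
def sigCoord {k : ℕ} {mdim : Fin k → ℕ} (x : Fin (∑ i, mdim i) → ℝ) (i : Fin k) :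
    Fin (mdim i) → ℝ := fun a => x (sigmaFinEquiv mdim ⟨i, a⟩)

/-- The block-diagonal metric of a finite direct product, in coordinates. -/
def multiBlockMetric {k : ℕ} {mdim : Fin k → ℕ}
    (G : (i : Fin k) → MetricMat (mdim i)) : MetricMat (∑ i, mdim i) := fun x a b =>
  let sa := (sigmaFinEquiv mdim).symm a
  let sb := (sigmaFinEquiv mdim).symm b
  if h : sa.1 = sb.1 then G sb.1 (sigCoord x sb.1) (h ▸ sa.2) sb.2 else 0

/-- `X` is globally isometric to the direct product of the coordinate spacetime
`(ℝ^d, Gcw)` with the finite family of manifolds `Y i` (with the product metric). -/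
def GloballyIsometricToCWMultiProd {n d k : ℕ} {mdim : Fin k → ℕ}
    (X : PRManifold n) (Gcw : MetricMat d)
    (Y : (i : Fin k) → PRManifold (mdim i)) : Prop :=
  ∃ F : X.M → (Fin d → ℝ) × ((i : Fin k) → (Y i).M), Function.Bijective F ∧
    ∀ p : X.M, ∃ S, IsOpen S ∧ (X.chartAt p).φ p ∈ S ∧ S ⊆ (X.chartAt p).ran ∧
      (∀ x ∈ S, ∀ i, (F ((X.chartAt p).ψ x)).2 i ∈ ((Y i).chartAt ((F p).2 i)).dom) ∧
      IsPullbackIsometry (X.chartAt p).g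
        (prodMetricMat Gcw (multiBlockMetric fun i => ((Y i).chartAt ((F p).2 i)).g))
        (fun x => Fin.append (F ((X.chartAt p).ψ x)).1
          (fun j => let s := (sigmaFinEquiv mdim).symm j
            ((Y s.1).chartAt ((F p).2 s.1)).φ ((F ((X.chartAt p).ψ x)).2 s.1) s.2)) S

/-- `X` is locally isometric to the direct product of the coordinate spacetime
`(ℝ^d, Gcw)` with the finite family of manifolds `Y i`. -/
def LocallyIsometricToCWMultiProd {n d k : ℕ} {mdim : Fin k → ℕ}
    (X : PRManifold n) (Gcw : MetricMat d)
    (Y : (i : Fin k) → PRManifold (mdim i)) : Prop :=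
  ∀ p : X.M, ∃ q : (i : Fin k) → (Y i).M, ∃ S, IsOpen S ∧ (X.chartAt p).φ p ∈ S ∧
    S ⊆ (X.chartAt p).ran ∧
    ∃ τ : (Fin n → ℝ) → Fin (d + ∑ i, mdim i) → ℝ,
      (∀ x ∈ S, ∀ i : Fin k,
        sigCoord (split2 (n₁ := d) (τ x)) i ∈ ((Y i).chartAt (q i)).ran) ∧
      IsPullbackIsometry (X.chartAt p).g
        (prodMetricMat Gcw (multiBlockMetric fun i => ((Y i).chartAt (q i)).g)) τ S

/-- `X'` (with projection `π`) is a universal covering of `X`, with the pulled-back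
metric: `π` is a topological covering map, `X'` is simply connected and `π` is a local
isometry. -/
def IsUniversalCoverOf {n : ℕ} (X' X : PRManifold n) (π : X'.M → X.M) : Prop :=
  IsCoveringMap π ∧ X'.SimplyConn ∧
    ∀ p : X'.M, ∃ S, IsOpen S ∧ (X'.chartAt p).φ p ∈ S ∧ S ⊆ (X'.chartAt p).ran ∧
      (∀ x ∈ S, π ((X'.chartAt p).ψ x) ∈ (X.chartAt (π p)).dom) ∧
      IsPullbackIsometry (X'.chartAt p).g (X.chartAt (π p)).g
        (fun x => (X.chartAt (π p)).φ (π ((X'.chartAt p).ψ x))) S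

section TensorAction

variable {n s : ℕ}

/-- The infinitesimal action of a matrix on covariant tensors, slot by slot. -/
def tensorAct (n s : ℕ) :
    Matrix (Fin n) (Fin n) ℝ →ₗ[ℝ] ((Fin s → Fin n) → ℝ) →ₗ[ℝ] ((Fin s → Fin n) → ℝ) :=
  LinearMap.mk₂ ℝ
    (fun A S I => ∑ a : Fin s, ∑ e, A e (I a) * S (Function.update I a e))
    (fun A B S => by
      funext I
      simp only [Matrix.add_apply, Pi.add_apply, add_mul, Finset.sum_add_distrib])
    (fun c A S => by
      funext I
      simp only [Matrix.smul_apply, Pi.smul_apply, smul_eq_mul, Finset.mul_sum, mul_assoc])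
    (fun A S T => by
      funext I
      simp only [Pi.add_apply, mul_add, Finset.sum_add_distrib])
    (fun c A S => by
      funext I
      simp only [Pi.smul_apply, smul_eq_mul, Finset.mul_sum, mul_left_comm])

theorem tensorAct_apply (A : Matrix (Fin n) (Fin n) ℝ) (S : (Fin s → Fin n) → ℝ)
    (I : Fin s → Fin n) :
    tensorAct n s A S I = ∑ a : Fin s, ∑ e, A e (I a) * S (Function.update I a e) := rfl

/-- The action of a matrix on a single slot of a covariant tensor. -/
def slotAct (a : Fin s) (A : Matrix (Fin n) (Fin n) ℝ) (S : (Fin s → Fin n) → ℝ) :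
    (Fin s → Fin n) → ℝ :=
  fun I => ∑ e, A e (I a) * S (Function.update I a e)

theorem tensorAct_eq_sum_slotAct (A : Matrix (Fin n) (Fin n) ℝ) (S : (Fin s → Fin n) → ℝ) :
    tensorAct n s A S = ∑ a, slotAct a A S := by
  funext I
  simp [tensorAct_apply, slotAct]

theorem slotAct_sum {ι : Type*} (t : Finset ι) (a : Fin s) (A : Matrix (Fin n) (Fin n) ℝ)
    (S : ι → (Fin s → Fin n) → ℝ) :
    slotAct a A (∑ i ∈ t, S i) = ∑ i ∈ t, slotAct a A (S i) := by
  funext I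
  simp only [slotAct, Finset.sum_apply, Finset.mul_sum]
  rw [Finset.sum_comm]

theorem slotAct_slotAct_self (a : Fin s) (A B : Matrix (Fin n) (Fin n) ℝ)
    (S : (Fin s → Fin n) → ℝ) : slotAct a A (slotAct a B S) = slotAct a (B * A) S := by
  funext I
  simp only [slotAct, Function.update_self, Function.update_idem, Matrix.mul_apply,
    Finset.mul_sum, Finset.sum_mul]
  rw [Finset.sum_comm]
  exact Finset.sum_congr rfl fun f _ => Finset.sum_congr rfl fun e _ => by ring

theorem slotAct_comm {a b : Fin s} (hab : a ≠ b) (A B : Matrix (Fin n) (Fin n) ℝ)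
    (S : (Fin s → Fin n) → ℝ) :
    slotAct a A (slotAct b B S) = slotAct b B (slotAct a A S) := by
  funext I
  simp only [slotAct, Function.update_of_ne hab, Function.update_of_ne hab.symm, Finset.mul_sum]
  rw [Finset.sum_comm]
  refine Finset.sum_congr rfl fun f _ => Finset.sum_congr rfl fun e _ => ?_
  rw [Function.update_comm hab]
  ring

theorem tensorAct_commutator (A B : Matrix (Fin n) (Fin n) ℝ) (S : (Fin s → Fin n) → ℝ) :
    tensorAct n s A (tensorAct n s B S) - tensorAct n s B (tensorAct n s A S)
      = tensorAct n s (B * A - A * B) S := by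
  have key : ∀ A B : Matrix (Fin n) (Fin n) ℝ, tensorAct n s A (tensorAct n s B S)
      = ∑ a, (slotAct a (B * A) S + ∑ b ∈ Finset.univ.erase a, slotAct a A (slotAct b B S)) := by
    intro A B
    rw [tensorAct_eq_sum_slotAct, tensorAct_eq_sum_slotAct]
    refine Finset.sum_congr rfl fun a _ => ?_
    rw [slotAct_sum, ← Finset.add_sum_erase _ _ (Finset.mem_univ a), slotAct_slotAct_self]
  rw [key A B, key B A, map_sub, LinearMap.sub_apply, Finset.sum_add_distrib,
    Finset.sum_add_distrib, ← tensorAct_eq_sum_slotAct, ← tensorAct_eq_sum_slotAct]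
  have hc : ∑ a, ∑ b ∈ Finset.univ.erase a, slotAct a A (slotAct b B S)
      = ∑ a, ∑ b ∈ Finset.univ.erase a, slotAct a B (slotAct b A S) := by
    rw [Finset.sum_comm' (t' := Finset.univ) (s' := fun b => Finset.univ.erase b)
      (fun a b => by simp [eq_comm])]
    refine Finset.sum_congr rfl fun b _ => Finset.sum_congr rfl fun a ha => ?_
    exact slotAct_comm (Finset.ne_of_mem_erase ha) A B S
  rw [hc]
  abel

theorem tensorAct_cons (A : Matrix (Fin n) (Fin n) ℝ) (T : (Fin (s + 1) → Fin n) → ℝ)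
    (b : Fin n) (I : Fin s → Fin n) :
    tensorAct n (s + 1) A T (Fin.cons b I)
      = ∑ e, A e b * T (Fin.cons e I) + tensorAct n s A (fun J => T (Fin.cons b J)) I := by
  simp only [tensorAct_apply, Fin.sum_univ_succ, Fin.cons_zero, Fin.cons_succ,
    Fin.update_cons_zero, Fin.cons_update]

theorem sum_tensorAct_mul_add (A : Matrix (Fin n) (Fin n) ℝ) (hA : Aᵀ = -A)
    (S T : (Fin s → Fin n) → ℝ) :
    ∑ I, tensorAct n s A S I * T I + ∑ I, S I * tensorAct n s A T I = 0 := by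
  have hA' : ∀ i j, A i j = - A j i := fun i j => by
    have := congrFun (congrFun hA j) i
    simpa using this
  have slot : ∀ a : Fin s, ∑ I, slotAct a A S I * T I + ∑ I, S I * slotAct a A T I = 0 := by
    intro a
    simp only [slotAct, Finset.sum_mul, Finset.mul_sum]
    rw [← Fintype.sum_prod_type', ← Fintype.sum_prod_type', add_eq_zero_iff_eq_neg,
      ← Finset.sum_neg_distrib]
    let σ : (Fin s → Fin n) × Fin n → (Fin s → Fin n) × Fin n :=
      fun p => (Function.update p.1 a p.2, p.1 a)
    have hσ : Function.Involutive σ := by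
      rintro ⟨I, e⟩
      simp [σ]
    refine Fintype.sum_bijective σ hσ.bijective _ _ ?_
    rintro ⟨I, e⟩
    simp only [σ, Function.update_self, Function.update_idem, Function.update_eq_self]
    rw [hA' e (I a)]
    ring
  simp only [tensorAct_eq_sum_slotAct, Finset.sum_apply, Finset.sum_mul, Finset.mul_sum]
  rw [Finset.sum_comm, Finset.sum_comm (s := Finset.univ (α := Fin s → Fin n)),
    ← Finset.sum_add_distrib]
  exact Finset.sum_eq_zero fun a _ => slot a

/-- Pullback of a covariant tensor by a linear map, given by its matrix. -/
def tensorPull (P : Matrix (Fin n) (Fin n) ℝ) (S : (Fin s → Fin n) → ℝ) :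
    (Fin s → Fin n) → ℝ :=
  fun Q => ∑ I, (∏ a, P (I a) (Q a)) * S I

theorem tensorPull_one (S : (Fin s → Fin n) → ℝ) : tensorPull 1 S = S := by
  funext Q
  rw [tensorPull, Finset.sum_eq_single Q]
  · simp
  · intro I _ hI
    obtain ⟨a, ha⟩ := Function.ne_iff.mp hI
    have h0 : (1 : Matrix (Fin n) (Fin n) ℝ) (I a) (Q a) = 0 := Matrix.one_apply_ne ha
    have h1 : ∏ a, (1 : Matrix (Fin n) (Fin n) ℝ) (I a) (Q a) = 0 :=
      Finset.prod_eq_zero (Finset.mem_univ a) h0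
    rw [h1, zero_mul]
  · simp

theorem tensorPull_tensorPull (P Q : Matrix (Fin n) (Fin n) ℝ) (S : (Fin s → Fin n) → ℝ) :
    tensorPull Q (tensorPull P S) = tensorPull (P * Q) S := by
  funext K
  simp only [tensorPull, Finset.mul_sum, Matrix.mul_apply]
  rw [Finset.sum_comm]
  refine Finset.sum_congr rfl fun I _ => ?_
  rw [Finset.prod_univ_sum, Fintype.piFinset_univ, Finset.sum_mul]
  refine Finset.sum_congr rfl fun J _ => ?_
  rw [Finset.prod_mul_distrib]
  ring

theorem tensorPull_tensorAct (P A B : Matrix (Fin n) (Fin n) ℝ) (h : A * P = P * B)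
    (S : (Fin s → Fin n) → ℝ) :
    tensorPull P (tensorAct n s A S) = tensorAct n s B (tensorPull P S) := by
  have slot : ∀ a : Fin s, tensorPull P (slotAct a A S) = slotAct a B (tensorPull P S) := by
    intro a
    funext Q
    simp only [tensorPull, slotAct, Finset.mul_sum]
    rw [Finset.sum_comm (s := Finset.univ (α := Fin n)), ← Fintype.sum_prod_type']
    let σ : (Fin s → Fin n) × Fin n → (Fin s → Fin n) × Fin n :=
      fun p => (Function.update p.1 a p.2, p.1 a)
    have hσ : Function.Involutive σ := by
      rintro ⟨I, e⟩
      simp [σ]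
    rw [Fintype.sum_bijective σ hσ.bijective _
      (fun p => (∏ b, P (Function.update p.1 a p.2 b) (Q b)) * (A (p.1 a) p.2 * S p.1))
      (by rintro ⟨I, e⟩; simp [σ]), Fintype.sum_prod_type]
    refine Finset.sum_congr rfl fun J _ => ?_
    have split : ∀ (R : Fin s → Fin n) (e f : Fin n),
        (∏ b, P (Function.update J a e b) (Function.update R a f b))
          = P e f * ∏ b ∈ Finset.univ.erase a, P (J b) (R b) := by
      intro R e f
      rw [← Finset.mul_prod_erase _ _ (Finset.mem_univ a)]
      simp only [Function.update_self]
      congr 1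
      refine Finset.prod_congr rfl fun b hb => ?_
      simp [Function.update_of_ne (Finset.ne_of_mem_erase hb)]
    have h1 := fun e => split Q e (Q a)
    have h2 := fun f => split Q (J a) f
    simp only [Function.update_eq_self] at h1 h2
    simp only [h1, h2]
    have hm := congrFun (congrFun h (J a)) (Q a)
    simp only [Matrix.mul_apply] at hm
    calc ∑ e, P e (Q a) * (∏ b ∈ Finset.univ.erase a, P (J b) (Q b)) * (A (J a) e * S J)
        = (∑ e, A (J a) e * P e (Q a)) * ((∏ b ∈ Finset.univ.erase a, P (J b) (Q b)) * S J) := by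
          rw [Finset.sum_mul]
          exact Finset.sum_congr rfl fun e _ => by ring
      _ = _ := by
          rw [hm, Finset.sum_mul]
          exact Finset.sum_congr rfl fun e _ => by ring
  rw [tensorAct_eq_sum_slotAct, tensorAct_eq_sum_slotAct, ← Finset.sum_congr rfl fun a _ => slot a]
  funext Q
  simp only [tensorPull, Finset.sum_apply, Finset.mul_sum]
  rw [Finset.sum_comm]

end TensorAction

section PointwiseAlgebra

variable {n s : ℕ}

open scoped MatrixOrder Matrix.Norms.L2Operator in
theorem exists_transpose_mul_self_of_posDef {g : Matrix (Fin n) (Fin n) ℝ} (hg : g.PosDef) :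
    ∃ C : Matrix (Fin n) (Fin n) ℝ, IsUnit C.det ∧ g = Cᵀ * C := by
  obtain ⟨C, hC⟩ := (CStarAlgebra.nonneg_iff_eq_star_mul_self).mp hg.posSemidef.nonneg
  rw [Matrix.star_eq_conjTranspose, Matrix.conjTranspose_eq_transpose_of_trivial] at hC
  have hdet : IsUnit C.det := by
    have h := (Matrix.isUnit_iff_isUnit_det g).mp hg.isUnit
    rw [hC, Matrix.det_mul] at h
    exact isUnit_of_mul_isUnit_right h
  exact ⟨C, hdet, hC⟩

theorem exists_orthonormalizing_matrix {g : Matrix (Fin n) (Fin n) ℝ} (hg : g.PosDef) :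
    ∃ P : Matrix (Fin n) (Fin n) ℝ, Pᵀ * g * P = 1 ∧ P * (Pᵀ * g) = 1 := by
  obtain ⟨C, hdet, hC⟩ := exists_transpose_mul_self_of_posDef hg
  have h1 : (C⁻¹)ᵀ * g * C⁻¹ = 1 := by
    calc (C⁻¹)ᵀ * g * C⁻¹ = (C * C⁻¹)ᵀ * (C * C⁻¹) := by
          rw [hC, Matrix.transpose_mul]
          simp only [Matrix.mul_assoc]
      _ = 1 := by rw [Matrix.mul_nonsing_inv _ hdet, Matrix.transpose_one, Matrix.one_mul]
  exact ⟨C⁻¹, h1, mul_eq_one_comm.mp h1⟩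

theorem eq_zero_of_transpose_mul_posDef_mul_self {g A : Matrix (Fin n) (Fin n) ℝ}
    (hg : g.PosDef) (h : Aᵀ * g * A = 0) : A = 0 := by
  obtain ⟨C, hdet, hC⟩ := exists_transpose_mul_self_of_posDef hg
  have h1 : (C * A)ᴴ * (C * A) = 0 := by
    rw [Matrix.conjTranspose_eq_transpose_of_trivial, Matrix.transpose_mul, ← h, hC]
    simp only [Matrix.mul_assoc]
  have h2 := Matrix.conjTranspose_mul_self_eq_zero.mp h1
  rw [← Matrix.one_mul A, ← Matrix.nonsing_inv_mul _ hdet, Matrix.mul_assoc, h2, Matrix.mul_zero]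

/-- The symmetric bilinear form on covariant tensors obtained by pulling the standard one back
along a matrix. -/
def pullInner (P : Matrix (Fin n) (Fin n) ℝ) :
    ((Fin s → Fin n) → ℝ) →ₗ[ℝ] ((Fin s → Fin n) → ℝ) →ₗ[ℝ] ℝ :=
  LinearMap.mk₂ ℝ (fun S T => ∑ Q, tensorPull P S Q * tensorPull P T Q)
    (fun S S' T => by
      simp only [tensorPull, Pi.add_apply, mul_add, add_mul, Finset.sum_add_distrib])
    (fun c S T => by
      simp only [tensorPull, Pi.smul_apply, smul_eq_mul, Finset.mul_sum, Finset.sum_mul]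
      exact Finset.sum_congr rfl fun _ _ => Finset.sum_congr rfl fun _ _ =>
        Finset.sum_congr rfl fun _ _ => by ring)
    (fun S T T' => by
      simp only [tensorPull, Pi.add_apply, mul_add, Finset.sum_add_distrib])
    (fun c S T => by
      simp only [tensorPull, Pi.smul_apply, smul_eq_mul, Finset.mul_sum, Finset.sum_mul]
      exact Finset.sum_congr rfl fun _ _ => Finset.sum_congr rfl fun _ _ =>
        Finset.sum_congr rfl fun _ _ => by ring)

theorem pullInner_apply (P : Matrix (Fin n) (Fin n) ℝ) (S T : (Fin s → Fin n) → ℝ) :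
    pullInner P S T = ∑ Q, tensorPull P S Q * tensorPull P T Q := rfl

/-- A positive definite metric induces an inner product on covariant tensors for which every
skew-adjoint endomorphism acts by skew-adjoint operators. -/
theorem exists_invariant_inner (s : ℕ) {g : Matrix (Fin n) (Fin n) ℝ} (hg : g.PosDef) :
    ∃ B : ((Fin s → Fin n) → ℝ) →ₗ[ℝ] ((Fin s → Fin n) → ℝ) →ₗ[ℝ] ℝ,
      (∀ S, B S S = 0 → S = 0) ∧ (∀ S T, B S T = B T S) ∧
      ∀ A, (g * A)ᵀ = -(g * A) → ∀ S T, B (tensorAct n s A S) T + B S (tensorAct n s A T) = 0 := by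
  obtain ⟨P, hP, hP'⟩ := exists_orthonormalizing_matrix hg
  refine ⟨pullInner P, fun S hS => ?_, fun S T => ?_, fun A hA S T => ?_⟩
  · rw [pullInner_apply, Finset.sum_eq_zero_iff_of_nonneg fun _ _ => mul_self_nonneg _] at hS
    have h0 : tensorPull P S = 0 := by
      funext Q
      exact mul_self_eq_zero.mp (hS Q (Finset.mem_univ Q))
    rw [← tensorPull_one S, ← hP', ← tensorPull_tensorPull, h0]
    funext Q
    exact Finset.sum_eq_zero fun I _ => mul_zero _
  · simp only [pullInner_apply, mul_comm]
  · have hPA : A * P = P * (Pᵀ * (g * A) * P) := by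
      calc A * P = (P * (Pᵀ * g)) * (A * P) := by rw [hP', Matrix.one_mul]
        _ = _ := by simp only [Matrix.mul_assoc]
    rw [pullInner_apply, pullInner_apply, tensorPull_tensorAct P A _ hPA,
      tensorPull_tensorAct P A _ hPA]
    refine sum_tensorAct_mul_add _ ?_ _ _
    rw [Matrix.transpose_mul, Matrix.transpose_mul, hA, Matrix.transpose_transpose]
    simp only [Matrix.mul_assoc, Matrix.neg_mul, Matrix.mul_neg]

/-- Pair symmetry of an algebraic curvature tensor. -/
theorem pair_symm_of_bianchi {ι : Type*} (R : ι → ι → ι → ι → ℝ)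
    (h12 : ∀ l k a b, R l k a b = -R k l a b) (h34 : ∀ l k a b, R l k a b = -R l k b a)
    (hB : ∀ l k a b, R l k a b + R l a b k + R l b k a = 0) (l k a b : ι) :
    R l k a b = R a b l k := by
  linarith [hB l k a b, hB k l a b, hB a l k b, hB b l k a, h12 l k a b, h12 l a b k, h12 l b k a,
    h12 k a b l, h12 k b l a, h12 a b l k, h34 k l a b, h34 k a b l, h34 k b l a, h34 a l k b,
    h34 a k b l, h34 a b l k, h34 b l k a, h34 b k a l, h34 b a l k, h34 l a b k, h34 l b k a,
    h12 a k b l, h12 a l k b, h12 b l k a, h12 b k a l, h12 b a l k]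

/-- A tensor antisymmetric in its slots `h, f, k` and in its slots `d, e` vanishes if its
cyclic sum over `d, e, f` does. -/
theorem eq_zero_of_antisymm_of_cyclic {ι : Type*} (N : ι → ι → ι → ι → ι → ℝ)
    (hde : ∀ h d e f k, N h d e f k = -N h e d f k)
    (hhf : ∀ h d e f k, N h d e f k = -N f d e h k)
    (hfk : ∀ h d e f k, N h d e f k = -N h d e k f)
    (hcyc : ∀ h d e f k, N h d e f k + N h e f d k + N h f d e k = 0) (h d e f k : ι) :
    N h d e f k = 0 := by
  have c0 := hcyc h e f k d
  have c1 := hcyc h d f k e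
  have c2 := hcyc h d e k f
  have c3 := hcyc h d e f k
  have c4 := hcyc d h f k e
  have c5 := hcyc d h e k f
  have c6 := hcyc d h e f k
  have c7 := hcyc e h d k f
  have c8 := hcyc e h d f k
  have c9 := hcyc f h d e k
  clear hcyc
  grind

end PointwiseAlgebra

section ParallelDerivative

variable {n : ℕ}

/-- A tensor with the symmetries of a covariant derivative of a curvature tensor which is
annihilated by its own endomorphisms `M c a b`, and satisfies the twice differentiated
semi-symmetry condition, vanishes. -/
theorem eq_zero_of_semisymmetric {g : Matrix (Fin n) (Fin n) ℝ} (hg : g.PosDef)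
    (T : (Fin 5 → Fin n) → ℝ) (M : Fin n → Fin n → Fin n → Matrix (Fin n) (Fin n) ℝ)
    (hM : ∀ c a b l k, (g * M c a b) l k = T ![c, l, k, a, b])
    (h12 : ∀ c l k a b, T ![c, l, k, a, b] = -T ![c, k, l, a, b])
    (h34 : ∀ c l k a b, T ![c, l, k, a, b] = -T ![c, l, k, b, a])
    (hB1 : ∀ c l k a b, T ![c, l, k, a, b] + T ![c, l, a, b, k] + T ![c, l, b, k, a] = 0)
    (hB2 : ∀ c l k a b, T ![c, l, k, a, b] + T ![a, l, k, b, c] + T ![b, l, k, c, a] = 0)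
    (hT : ∀ c a b, tensorAct n 5 (M c a b) T = 0)
    (hTT : ∀ c d a b, tensorAct n 4 (M c a b) (fun I => T (Fin.cons d I))
      + tensorAct n 4 (M d a b) (fun I => T (Fin.cons c I)) = 0) :
    T = 0 := by
  have hsymm : gᵀ = g := by
    rw [← Matrix.conjTranspose_eq_transpose_of_trivial]
    exact hg.isHermitian
  have hdet : IsUnit g.det := (Matrix.isUnit_iff_isUnit_det g).mp hg.isUnit
  have hcancel : ∀ A B : Matrix (Fin n) (Fin n) ℝ, g * A = g * B → A = B := fun A B h => by
    rw [← Matrix.one_mul A, ← Matrix.one_mul B, ← Matrix.nonsing_inv_mul _ hdet,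
      Matrix.mul_assoc, h, Matrix.mul_assoc]
  have hskew : ∀ c a b, (g * M c a b)ᵀ = -(g * M c a b) := fun c a b => by
    ext l k
    rw [Matrix.transpose_apply, Matrix.neg_apply, hM, hM, h12]
  have hM34 : ∀ c a b, M c a b = -M c b a := fun c a b => hcancel _ _ <| by
    ext l k
    rw [Matrix.mul_neg, Matrix.neg_apply, hM, hM, h34]
  have hMB1 : ∀ c a b k m, M c a b m k + M c b k m a + M c k a m b = 0 := by
    intro c a b k m
    have h : ∀ l, ∑ m, g l m * (M c a b m k + M c b k m a + M c k a m b) = 0 := fun l => by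
      have := hB1 c l k a b
      simp only [← hM, Matrix.mul_apply] at this
      simpa only [mul_add, Finset.sum_add_distrib] using this
    have hv : g *ᵥ (fun m => M c a b m k + M c b k m a + M c k a m b) = 0 := funext h
    have hw := congrArg (fun v => g⁻¹ *ᵥ v) hv
    simp only [Matrix.mulVec_mulVec, Matrix.nonsing_inv_mul _ hdet, Matrix.one_mulVec,
      Matrix.mulVec_zero] at hw
    exact congrFun hw m
  -- the contraction of `T` with its own image
  let t : Fin n → (Fin 4 → Fin n) → ℝ := fun d I => T (Fin.cons d I)
  let τ : Fin n → Fin n → Fin n → Fin n → (Fin 4 → Fin n) → ℝ :=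
    fun h d e f => ∑ m, M h d e m f • t m
  have hτ : ∀ h d e f, τ h d e f = -tensorAct n 4 (M h d e) (t f) := by
    intro h d e f
    funext I
    have := congrFun (hT h d e) (Fin.cons f I)
    rw [tensorAct_cons] at this
    simp only [τ, Finset.sum_apply, Pi.smul_apply, smul_eq_mul, Pi.neg_apply]
    exact eq_neg_of_add_eq_zero_left this
  obtain ⟨B, hB0, hBsymm, hBskew⟩ := exists_invariant_inner 4 hg
  have hN : ∀ h d e f k, B (τ h d e f) (t k) = 0 := by
    refine eq_zero_of_antisymm_of_cyclic (fun h d e f k => B (τ h d e f) (t k)) ?_ ?_ ?_ ?_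
    · intro h d e f k
      simp only [hτ, hM34 h d e, map_neg, LinearMap.neg_apply]
    · intro h d e f k
      have : τ h d e f = -τ f d e h := by
        rw [hτ, hτ, ← sub_eq_zero, ← neg_eq_zero]
        convert hTT h f d e using 1
        abel
      simp only [this, map_neg, LinearMap.neg_apply]
    · intro h d e f k
      have := hBskew (M h d e) (hskew h d e) (t f) (t k)
      simp only [hτ, map_neg, LinearMap.neg_apply]
      rw [hBsymm (t f)] at this
      linarith
    · intro h d e f k
      have : τ h d e f + τ h e f d + τ h f d e = 0 := by
        simp only [τ, ← Finset.sum_add_distrib, ← add_smul, hMB1, zero_smul,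
          Finset.sum_const_zero]
      simp only [← LinearMap.add_apply, ← map_add, this, map_zero, LinearMap.zero_apply]
  have hτ0 : ∀ h d e f, τ h d e f = 0 := fun h d e f => hB0 _ <| by
    conv_lhs => enter [2]; simp only [τ]
    rw [map_sum]
    exact Finset.sum_eq_zero fun m _ => by rw [map_smul, hN, smul_zero]
  have hcontr : ∀ h d e f l k a b, ∑ m, M h d e m f * T ![m, l, k, a, b] = 0 := by
    intro h d e f l k a b
    have := congrFun (hτ0 h d e f) ![l, k, a, b]
    simp only [τ, Finset.sum_apply, Pi.smul_apply, smul_eq_mul] at this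
    exact this
  have hpair : ∀ c l k a b, T ![c, l, k, a, b] = T ![c, a, b, l, k] := fun c =>
    pair_symm_of_bianchi (fun l k a b => T ![c, l, k, a, b]) (h12 c) (h34 c) (hB1 c)
  -- slots in the image of the endomorphisms
  have himage : ∀ (h d e h' d' e' c x y : Fin n),
      (M h d e)ᵀ * (g * M c x y) * M h' d' e' = 0 := by
    intro h d e h' d' e' c x y
    ext i j
    have hexp : ∀ p q, (g * M c x y) p q = -T ![p, x, y, q, c] - T ![q, x, y, c, p] := by
      intro p q
      rw [hM, hpair]
      linarith [hB2 c x y p q]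
    simp only [Matrix.mul_apply (M := _ * _) , Matrix.mul_apply (M := (M h d e)ᵀ),
      Matrix.transpose_apply, hexp, Matrix.zero_apply]
    have e1 : ∀ q, ∑ p, M h d e p i * T ![p, x, y, q, c] = 0 := fun q => hcontr h d e i x y q c
    have e2 : ∀ p, ∑ q, M h' d' e' q j * T ![q, x, y, c, p] = 0 := fun p =>
      hcontr h' d' e' j x y c p
    simp only [mul_sub, mul_neg, Finset.sum_sub_distrib, Finset.sum_neg_distrib, e1, neg_zero,
      zero_sub, Finset.sum_mul, neg_mul]
    rw [Finset.sum_comm, neg_eq_zero]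
    refine Finset.sum_eq_zero fun p _ => ?_
    simp only [mul_assoc]
    rw [← Finset.mul_sum]
    rw [Finset.sum_congr rfl fun q _ => mul_comm (T ![q, x, y, c, p]) (M h' d' e' q j), e2,
      mul_zero]
  have htr : ∀ c x y, (M c x y)ᵀ * g = -(g * M c x y) := fun c x y => by
    rw [← hskew, Matrix.transpose_mul, hsymm]
  have hsq : ∀ c x y, M c x y * M c x y = 0 := by
    intro c x y
    apply eq_zero_of_transpose_mul_posDef_mul_self hg
    rw [Matrix.transpose_mul]
    have := himage c x y c x y c x y
    calc (M c x y)ᵀ * (M c x y)ᵀ * g * (M c x y * M c x y)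
        = (M c x y)ᵀ * ((M c x y)ᵀ * g) * M c x y * M c x y := by
          simp only [Matrix.mul_assoc]
      _ = -((M c x y)ᵀ * (g * M c x y) * M c x y) * M c x y := by
          rw [htr]; simp only [Matrix.mul_neg, Matrix.neg_mul]
      _ = 0 := by rw [this]; simp
  have hM0 : ∀ c x y, M c x y = 0 := by
    intro c x y
    apply eq_zero_of_transpose_mul_posDef_mul_self hg
    rw [htr, Matrix.neg_mul, Matrix.mul_assoc, hsq, Matrix.mul_zero, neg_zero]
  funext I
  have hI : I = ![I 0, I 1, I 2, I 3, I 4] := by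
    funext i
    fin_cases i <;> rfl
  rw [hI, ← hM, hM0, Matrix.mul_zero, Matrix.zero_apply, Pi.zero_apply]

end ParallelDerivative

section PartialDerivatives

variable {n : ℕ} {U : Set (Fin n → ℝ)} {f h : (Fin n → ℝ) → ℝ} {x : Fin n → ℝ}

/-- Smoothness of a real function on a subset of coordinate space. -/
abbrev SmoothOn (U : Set (Fin n → ℝ)) (f : (Fin n → ℝ) → ℝ) : Prop :=
  ContDiffOn ℝ (⊤ : ℕ∞) f U

theorem SmoothOn.differentiableAt (hf : SmoothOn U f) (hU : IsOpen U) (hx : x ∈ U) :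
    DifferentiableAt ℝ f x :=
  (hf.contDiffAt (hU.mem_nhds hx)).differentiableAt (by simp)

theorem SmoothOn.sum {ι : Type*} {t : Finset ι} {F : ι → (Fin n → ℝ) → ℝ}
    (hF : ∀ i ∈ t, SmoothOn U (F i)) : SmoothOn U (fun y => ∑ i ∈ t, F i y) :=
  ContDiffOn.sum hF

theorem SmoothOn.prod {ι : Type*} {t : Finset ι} {F : ι → (Fin n → ℝ) → ℝ}
    (hF : ∀ i ∈ t, SmoothOn U (F i)) : SmoothOn U (fun y => ∏ i ∈ t, F i y) :=
  contDiffOn_prod hF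

theorem SmoothOn.mul (hf : SmoothOn U f) (hh : SmoothOn U h) : SmoothOn U (fun y => f y * h y) :=
  ContDiffOn.mul hf hh

theorem SmoothOn.pd (hf : SmoothOn U f) (hU : IsOpen U) (i : Fin n) : SmoothOn U (pd i f) :=
  (hf.fderiv_of_isOpen hU (m := (⊤ : ℕ∞)) (by simp)).clm_apply contDiffOn_const

theorem pd_add (hf : DifferentiableAt ℝ f x) (hh : DifferentiableAt ℝ h x) (i : Fin n) :
    pd i (fun y => f y + h y) x = pd i f x + pd i h x := by
  simp [pd, fderiv_fun_add hf hh]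

theorem pd_sub (hf : DifferentiableAt ℝ f x) (hh : DifferentiableAt ℝ h x) (i : Fin n) :
    pd i (fun y => f y - h y) x = pd i f x - pd i h x := by
  simp [pd, fderiv_fun_sub hf hh]

theorem pd_neg (i : Fin n) : pd i (fun y => -f y) x = -pd i f x := by
  simp [pd, fderiv_fun_neg]

theorem pd_const (c : ℝ) (i : Fin n) : pd i (fun _ => c) x = 0 := by
  simp [pd]

theorem pd_mul (hf : DifferentiableAt ℝ f x) (hh : DifferentiableAt ℝ h x) (i : Fin n) :
    pd i (fun y => f y * h y) x = pd i f x * h x + f x * pd i h x := by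
  simp [pd, fderiv_fun_mul hf hh]
  ring

theorem pd_sum {ι : Type*} {t : Finset ι} {F : ι → (Fin n → ℝ) → ℝ}
    (hF : ∀ j ∈ t, DifferentiableAt ℝ (F j) x) (i : Fin n) :
    pd i (fun y => ∑ j ∈ t, F j y) x = ∑ j ∈ t, pd i (F j) x := by
  simp [pd, fderiv_fun_sum hF]

theorem pd_congr (hU : IsOpen U) (hx : x ∈ U) (hfh : ∀ y ∈ U, f y = h y) (i : Fin n) :
    pd i f x = pd i h x := by
  rw [pd, pd, Filter.EventuallyEq.fderiv_eq (Filter.eventually_of_mem (hU.mem_nhds hx) hfh)]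

theorem pd_eq_zero (hU : IsOpen U) (hx : x ∈ U) (hf : ∀ y ∈ U, f y = 0) (i : Fin n) :
    pd i f x = 0 := by
  rw [pd_congr hU hx hf, pd_const]

theorem pd_comm (hU : IsOpen U) (hf : SmoothOn U f) (hx : x ∈ U) (i j : Fin n) :
    pd i (pd j f) x = pd j (pd i f) x := by
  have hd : DifferentiableAt ℝ (fderiv ℝ f) x :=
    ((hf.fderiv_of_isOpen hU (m := (⊤ : ℕ∞)) (by simp)).contDiffAt
      (hU.mem_nhds hx)).differentiableAt (by simp)
  have key : ∀ i j, pd i (pd j f) x = fderiv ℝ (fderiv ℝ f) x (Pi.single i 1) (Pi.single j 1) := by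
    intro i j
    have : pd j f = fun y => fderiv ℝ f y (Pi.single j 1) := rfl
    rw [pd, this, fderiv_clm_apply hd (differentiableAt_const _)]
    simp
  rw [key, key]
  exact (hf.contDiffAt (hU.mem_nhds hx)).isSymmSndFDerivAt
    (by simpa using WithTop.coe_le_coe.mpr (le_top : (2 : ℕ∞) ≤ ⊤)) _ _

/-- Entrywise smoothness of a matrix-valued function. -/
abbrev MatSmoothOn (U : Set (Fin n → ℝ)) (X : MetricMat n) : Prop :=
  ∀ a b, SmoothOn U (fun y => X y a b)

/-- Entrywise partial derivative of a matrix-valued function. -/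
def matPd (i : Fin n) (X : MetricMat n) : MetricMat n :=
  fun x => Matrix.of fun a b => pd i (fun y => X y a b) x

theorem matPd_apply (i : Fin n) (X : MetricMat n) (x : Fin n → ℝ) (a b : Fin n) :
    matPd i X x a b = pd i (fun y => X y a b) x := rfl

theorem MatSmoothOn.mul {X Y : MetricMat n} (hX : MatSmoothOn U X) (hY : MatSmoothOn U Y) :
    MatSmoothOn U (fun y => X y * Y y) := fun a b => by
  simp only [Matrix.mul_apply]
  exact SmoothOn.sum fun m _ => (hX a m).mul (hY m b)

theorem MatSmoothOn.add {X Y : MetricMat n} (hX : MatSmoothOn U X) (hY : MatSmoothOn U Y) :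
    MatSmoothOn U (fun y => X y + Y y) := fun a b => ContDiffOn.add (hX a b) (hY a b)

theorem MatSmoothOn.sub {X Y : MetricMat n} (hX : MatSmoothOn U X) (hY : MatSmoothOn U Y) :
    MatSmoothOn U (fun y => X y - Y y) := fun a b => ContDiffOn.sub (hX a b) (hY a b)

theorem MatSmoothOn.transpose {X : MetricMat n} (hX : MatSmoothOn U X) :
    MatSmoothOn U (fun y => (X y)ᵀ) := fun a b => hX b a

theorem MatSmoothOn.matPd {X : MetricMat n} (hX : MatSmoothOn U X) (hU : IsOpen U) (i : Fin n) :
    MatSmoothOn U (matPd i X) := fun a b => (hX a b).pd hU i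

theorem MatSmoothOn.det {X : MetricMat n} (hX : MatSmoothOn U X) :
    SmoothOn U (fun y => (X y).det) := by
  simp only [Matrix.det_apply']
  exact SmoothOn.sum fun σ _ => contDiffOn_const.mul (SmoothOn.prod fun i _ => hX _ _)

theorem MatSmoothOn.inv {X : MetricMat n} (hX : MatSmoothOn U X)
    (hdet : ∀ y ∈ U, IsUnit (X y).det) : MatSmoothOn U (fun y => (X y)⁻¹) := fun a b => by
  simp only [Matrix.inv_def, Ring.inverse_eq_inv', Matrix.smul_apply, smul_eq_mul,
    Matrix.adjugate_apply]
  refine (hX.det.inv fun y hy => (hdet y hy).ne_zero).mul ?_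
  refine MatSmoothOn.det fun i j => ?_
  by_cases h : i = b
  · subst h
    simpa only [Matrix.updateRow_self] using contDiffOn_const
  · simpa only [Matrix.updateRow_ne h] using hX i j

theorem matPd_mul {X Y : MetricMat n} (hU : IsOpen U) (hX : MatSmoothOn U X)
    (hY : MatSmoothOn U Y) (hx : x ∈ U) (i : Fin n) :
    matPd i (fun y => X y * Y y) x = matPd i X x * Y x + X x * matPd i Y x := by
  ext a b
  simp only [matPd_apply, Matrix.add_apply, Matrix.mul_apply]
  rw [pd_sum fun m _ => (SmoothOn.mul (hX a m) (hY m b)).differentiableAt hU hx,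
    ← Finset.sum_add_distrib]
  exact Finset.sum_congr rfl fun m _ => pd_mul ((hX a m).differentiableAt hU hx)
    ((hY m b).differentiableAt hU hx) i

theorem matPd_add {X Y : MetricMat n} (hU : IsOpen U) (hX : MatSmoothOn U X)
    (hY : MatSmoothOn U Y) (hx : x ∈ U) (i : Fin n) :
    matPd i (fun y => X y + Y y) x = matPd i X x + matPd i Y x := by
  ext a b
  exact pd_add ((hX a b).differentiableAt hU hx) ((hY a b).differentiableAt hU hx) i

theorem matPd_sub {X Y : MetricMat n} (hU : IsOpen U) (hX : MatSmoothOn U X)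
    (hY : MatSmoothOn U Y) (hx : x ∈ U) (i : Fin n) :
    matPd i (fun y => X y - Y y) x = matPd i X x - matPd i Y x := by
  ext a b
  exact pd_sub ((hX a b).differentiableAt hU hx) ((hY a b).differentiableAt hU hx) i

theorem matPd_transpose (X : MetricMat n) (x : Fin n → ℝ) (i : Fin n) :
    matPd i (fun y => (X y)ᵀ) x = (matPd i X x)ᵀ := rfl

theorem matPd_congr {X Y : MetricMat n} (hU : IsOpen U) (hx : x ∈ U)
    (hXY : ∀ y ∈ U, X y = Y y) (i : Fin n) : matPd i X x = matPd i Y x := by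
  ext a b
  exact pd_congr hU hx (fun y hy => by rw [hXY y hy]) i

theorem matPd_comm {X : MetricMat n} (hU : IsOpen U) (hX : MatSmoothOn U X) (hx : x ∈ U)
    (i j : Fin n) : matPd i (matPd j X) x = matPd j (matPd i X) x := by
  ext a b
  exact pd_comm hU (hX a b) hx i j

end PartialDerivatives

section CovariantCalculus

variable {n s : ℕ} {g : MetricMat n} {U : Set (Fin n → ℝ)} {x : Fin n → ℝ}

/-- Componentwise smoothness of a covariant tensor field. -/
abbrev TensorSmoothOn (U : Set (Fin n → ℝ)) (S : TensorField n s) : Prop :=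
  ∀ I, SmoothOn U (fun y => S y I)

/-- The matrix `(Γ_a)^e_i = Γ^e_{ai}` of Christoffel symbols. -/
def christoffelMat (g : MetricMat n) (a : Fin n) : MetricMat n :=
  fun x => Matrix.of fun e i => christoffel g x e a i

/-- The matrix `(F_{ab})^l_k = R^l_{kab}` of the curvature operator. -/
def curvMat (g : MetricMat n) (a b : Fin n) : MetricMat n :=
  fun x => Matrix.of fun l k => curvUp g x l k a b

/-- Componentwise partial derivative of a covariant tensor field. -/
def tensorPd (a : Fin n) (S : TensorField n s) : TensorField n s :=
  fun x I => pd a (fun y => S y I) x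

/-- Covariant derivative `∇_a S` of a covariant tensor field in a coordinate direction. -/
def covAlong (g : MetricMat n) (a : Fin n) (S : TensorField n s) : TensorField n s :=
  fun x => tensorPd a S x - tensorAct n s (christoffelMat g a x) (S x)

/-- Covariant derivative of a field of endomorphisms in a coordinate direction. -/
def endoCovAlong (g : MetricMat n) (a : Fin n) (F : MetricMat n) : MetricMat n :=
  fun x => matPd a F x + christoffelMat g a x * F x - F x * christoffelMat g a x

theorem covDeriv_cons (g : MetricMat n) (S : TensorField n s) (x : Fin n → ℝ) (a : Fin n)
    (I : Fin s → Fin n) : covDeriv g S x (Fin.cons a I) = covAlong g a S x I := rfl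

theorem TensorSmoothOn.tensorAct {F : MetricMat n} {S : TensorField n s} (hF : MatSmoothOn U F)
    (hS : TensorSmoothOn U S) : TensorSmoothOn U (fun y => tensorAct n s (F y) (S y)) := fun I => by
  simp only [tensorAct_apply]
  exact SmoothOn.sum fun a _ => SmoothOn.sum fun e _ => (hF _ _).mul (hS _)

theorem TensorSmoothOn.tensorPd {S : TensorField n s} (hS : TensorSmoothOn U S) (hU : IsOpen U)
    (a : Fin n) : TensorSmoothOn U (tensorPd a S) := fun I => (hS I).pd hU a

theorem tensorPd_tensorAct {F : MetricMat n} {S : TensorField n s} (hU : IsOpen U)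
    (hF : MatSmoothOn U F) (hS : TensorSmoothOn U S) (hx : x ∈ U) (c : Fin n) :
    tensorPd c (fun y => tensorAct n s (F y) (S y)) x
      = tensorAct n s (matPd c F x) (S x) + tensorAct n s (F x) (tensorPd c S x) := by
  funext I
  simp only [tensorPd, tensorAct_apply, Pi.add_apply, matPd_apply]
  rw [pd_sum fun a _ => (SmoothOn.sum fun e _ => (hF _ _).mul (hS _)).differentiableAt hU hx,
    ← Finset.sum_add_distrib]
  refine Finset.sum_congr rfl fun a _ => ?_
  rw [pd_sum fun e _ => ((hF _ _).mul (hS _)).differentiableAt hU hx, ← Finset.sum_add_distrib]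
  exact Finset.sum_congr rfl fun e _ => pd_mul ((hF _ _).differentiableAt hU hx)
    ((hS _).differentiableAt hU hx) c

theorem tensorPd_sub {S T : TensorField n s} (hU : IsOpen U) (hS : TensorSmoothOn U S)
    (hT : TensorSmoothOn U T) (hx : x ∈ U) (c : Fin n) :
    tensorPd c (fun y => S y - T y) x = tensorPd c S x - tensorPd c T x := by
  funext I
  exact pd_sub ((hS I).differentiableAt hU hx) ((hT I).differentiableAt hU hx) c

theorem covAlong_eq_zero {S : TensorField n s} (hU : IsOpen U) (hx : x ∈ U)
    (hS : ∀ y ∈ U, S y = 0) (c : Fin n) : covAlong g c S x = 0 := by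
  funext I
  simp only [covAlong, hS x hx, map_zero, sub_zero, tensorPd]
  exact pd_eq_zero hU hx (fun y hy => by rw [hS y hy]; rfl) c

theorem covAlong_add {S T : TensorField n s} (hU : IsOpen U) (hS : TensorSmoothOn U S)
    (hT : TensorSmoothOn U T) (hx : x ∈ U) (c : Fin n) :
    covAlong g c (fun y => S y + T y) x = covAlong g c S x + covAlong g c T x := by
  have h : tensorPd c (fun y => S y + T y) x = tensorPd c S x + tensorPd c T x := by
    funext I
    exact pd_add ((hS I).differentiableAt hU hx) ((hT I).differentiableAt hU hx) c
  simp only [covAlong, h, map_add]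
  abel

theorem covAlong_tensorAct {F : MetricMat n} {S : TensorField n s} (hU : IsOpen U)
    (hF : MatSmoothOn U F) (hS : TensorSmoothOn U S) (hx : x ∈ U) (c : Fin n) :
    covAlong g c (fun y => tensorAct n s (F y) (S y)) x
      = tensorAct n s (endoCovAlong g c F x) (S x) + tensorAct n s (F x) (covAlong g c S x) := by
  have h := tensorAct_commutator (F x) (christoffelMat g c x) (S x)
  simp only [covAlong, endoCovAlong, tensorPd_tensorAct hU hF hS hx, add_sub_assoc, map_add,
    LinearMap.add_apply, map_sub] at h ⊢
  rw [← h]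
  abel

/-- The endomorphism-valued components `(∇_c F)_{ab}` of the covariant derivative of the
curvature operator. -/
def nablaCurvMat (g : MetricMat n) (c a b : Fin n) : MetricMat n := fun x =>
  endoCovAlong g c (curvMat g a b) x - (∑ e, christoffelMat g c x e a • curvMat g e b x
    + ∑ e, christoffelMat g c x e b • curvMat g a e x)

/-- The geometric setting: a smooth nondegenerate symmetric metric on an open set. -/
structure IsSmoothMetricOn (g : MetricMat n) (U : Set (Fin n → ℝ)) : Prop where
  isOpen : IsOpen U
  smooth : MatSmoothOn U g
  symm : ∀ y ∈ U, (g y).IsSymm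
  nondeg : ∀ y ∈ U, IsUnit (g y).det

namespace IsSmoothMetricOn

theorem smooth_christoffelMat (hg : IsSmoothMetricOn g U) (a : Fin n) :
    MatSmoothOn U (christoffelMat g a) := fun e i => by
  have hd : ∀ k l m, SmoothOn U (fun y => pd k (fun z => g z l m) y) :=
    fun k l m => (hg.smooth l m).pd hg.isOpen k
  exact contDiffOn_const.mul (SmoothOn.sum fun l _ =>
    (hg.smooth.inv hg.nondeg e l).mul (((hd _ _ _).add (hd _ _ _)).sub (hd _ _ _)))

theorem smooth_covAlong (hg : IsSmoothMetricOn g U) {S : TensorField n s}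
    (hS : TensorSmoothOn U S) (a : Fin n) : TensorSmoothOn U (covAlong g a S) := fun I =>
  (hS.tensorPd hg.isOpen a I).sub (TensorSmoothOn.tensorAct (hg.smooth_christoffelMat a) hS I)

theorem smooth_covDeriv (hg : IsSmoothMetricOn g U) {S : TensorField n s}
    (hS : TensorSmoothOn U S) : TensorSmoothOn U (covDeriv g S) := fun I =>
  hg.smooth_covAlong hS (I 0) (fun b => I b.succ)

theorem curvMat_eq (g : MetricMat n) (a b : Fin n) (x : Fin n → ℝ) :
    curvMat g a b x = matPd a (christoffelMat g b) x - matPd b (christoffelMat g a) x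
      + christoffelMat g a x * christoffelMat g b x
      - christoffelMat g b x * christoffelMat g a x := rfl

theorem smooth_curvMat (hg : IsSmoothMetricOn g U) (a b : Fin n) :
    MatSmoothOn U (curvMat g a b) := by
  have hΓ := hg.smooth_christoffelMat
  exact ((((hΓ b).matPd hg.isOpen a).sub ((hΓ a).matPd hg.isOpen b)).add
    ((hΓ a).mul (hΓ b))).sub ((hΓ b).mul (hΓ a))

theorem smooth_riemann (hg : IsSmoothMetricOn g U) : TensorSmoothOn U (riemann g) := fun I =>
  (hg.smooth.mul (hg.smooth_curvMat (I 2) (I 3))) (I 0) (I 1)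

theorem smooth_nablaR (hg : IsSmoothMetricOn g U) : ∀ r, TensorSmoothOn U (nablaR g r)
  | 0 => hg.smooth_riemann
  | r + 1 => hg.smooth_covDeriv (hg.smooth_nablaR r)

theorem covAlong_covAlong_sub (hg : IsSmoothMetricOn g U) {S : TensorField n s}
    (hS : TensorSmoothOn U S) (hx : x ∈ U) (a b : Fin n) :
    covAlong g a (covAlong g b S) x - covAlong g b (covAlong g a S) x
      = -tensorAct n s (curvMat g a b x) (S x) := by
  have hΓ := hg.smooth_christoffelMat
  have key : ∀ a b, covAlong g a (covAlong g b S) x = tensorPd a (tensorPd b S) x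
      - (tensorAct n s (matPd a (christoffelMat g b) x) (S x)
        + tensorAct n s (christoffelMat g b x) (tensorPd a S x))
      - (tensorAct n s (christoffelMat g a x) (tensorPd b S x)
        - tensorAct n s (christoffelMat g a x) (tensorAct n s (christoffelMat g b x) (S x))) := by
    intro a b
    rw [covAlong]
    have h1 : covAlong g b S = fun y => tensorPd b S y
      - tensorAct n s (christoffelMat g b y) (S y) := rfl
    rw [h1, tensorPd_sub hg.isOpen (hS.tensorPd hg.isOpen b)
      (TensorSmoothOn.tensorAct (hΓ b) hS) hx, tensorPd_tensorAct hg.isOpen (hΓ b) hS hx, map_sub]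
  have hcomm : tensorPd a (tensorPd b S) x = tensorPd b (tensorPd a S) x := by
    funext I
    exact pd_comm hg.isOpen (hS I) hx a b
  have h := tensorAct_commutator (christoffelMat g a x) (christoffelMat g b x) (S x)
  rw [key a b, key b a, hcomm, curvMat_eq]
  simp only [map_sub, map_add, LinearMap.sub_apply, LinearMap.add_apply] at h ⊢
  linear_combination h

theorem metric_mul_christoffelMat (hg : IsSmoothMetricOn g U) (hx : x ∈ U) (a l i : Fin n) :
    (g x * christoffelMat g a x) l i = (1 / 2) *
      (pd a (fun y => g y l i) x + pd i (fun y => g y l a) x - pd l (fun y => g y a i) x) := by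
  have h : christoffelMat g a x = (g x)⁻¹ * Matrix.of fun l i => (1 / 2) *
      (pd a (fun y => g y l i) x + pd i (fun y => g y l a) x - pd l (fun y => g y a i) x) := by
    ext e i
    simp only [christoffelMat, christoffel, Matrix.of_apply, Matrix.mul_apply, Finset.mul_sum]
    exact Finset.sum_congr rfl fun l _ => by ring
  rw [h, ← Matrix.mul_assoc, Matrix.mul_nonsing_inv _ (hg.nondeg x hx), Matrix.one_mul]
  rfl

theorem matPd_metric (hg : IsSmoothMetricOn g U) (hx : x ∈ U) (a : Fin n) :
    matPd a g x = (christoffelMat g a x)ᵀ * g x + g x * christoffelMat g a x := by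
  have hs : ∀ c i j, pd c (fun y => g y i j) x = pd c (fun y => g y j i) x := fun c i j =>
    pd_congr hg.isOpen hx (fun y hy => (hg.symm y hy).apply j i) c
  have ht : (christoffelMat g a x)ᵀ * g x = (g x * christoffelMat g a x)ᵀ := by
    rw [Matrix.transpose_mul, (hg.symm x hx).eq]
  ext l i
  rw [ht, Matrix.add_apply, Matrix.transpose_apply, hg.metric_mul_christoffelMat hx,
    hg.metric_mul_christoffelMat hx, matPd_apply, hs a i l, hs l i a, hs i l a]
  ring

theorem christoffelMat_symm (hg : IsSmoothMetricOn g U) (hx : x ∈ U) (a e i : Fin n) :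
    christoffelMat g a x e i = christoffelMat g i x e a := by
  have hs : ∀ c i j, pd c (fun y => g y i j) x = pd c (fun y => g y j i) x := fun c i j =>
    pd_congr hg.isOpen hx (fun y hy => (hg.symm y hy).apply j i) c
  simp only [christoffelMat, christoffel, Matrix.of_apply]
  congr 1
  refine Finset.sum_congr rfl fun l _ => ?_
  rw [hs l a i]
  ring

theorem curvMat_antisymm (g : MetricMat n) (a b : Fin n) (x : Fin n → ℝ) :
    curvMat g a b x = -curvMat g b a x := by
  rw [curvMat_eq, curvMat_eq]
  abel

theorem metric_mul_curvMat_skew (hg : IsSmoothMetricOn g U) (hx : x ∈ U) (a b : Fin n) :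
    (g x * curvMat g a b x)ᵀ = -(g x * curvMat g a b x) := by
  have hΓ := hg.smooth_christoffelMat
  have key : ∀ a b, matPd a (matPd b g) x
      = (matPd a (christoffelMat g b) x)ᵀ * g x
        + (christoffelMat g b x)ᵀ * ((christoffelMat g a x)ᵀ * g x + g x * christoffelMat g a x)
        + (((christoffelMat g a x)ᵀ * g x + g x * christoffelMat g a x) * christoffelMat g b x
        + g x * matPd a (christoffelMat g b) x) := by
    intro a b
    rw [matPd_congr hg.isOpen hx (fun y hy => hg.matPd_metric hy b),
      matPd_add hg.isOpen ((hΓ b).transpose.mul hg.smooth) (hg.smooth.mul (hΓ b)) hx,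
      matPd_mul hg.isOpen (hΓ b).transpose hg.smooth hx,
      matPd_mul hg.isOpen hg.smooth (hΓ b) hx, matPd_transpose, hg.matPd_metric hx]
  have h := matPd_comm hg.isOpen hg.smooth hx a b
  rw [key a b, key b a, ← sub_eq_zero] at h
  rw [eq_neg_iff_add_eq_zero, Matrix.transpose_mul, (hg.symm x hx).eq, ← h, curvMat_eq]
  simp only [Matrix.transpose_sub, Matrix.transpose_add, Matrix.transpose_mul]
  noncomm_ring

theorem curvMat_cyclic (hg : IsSmoothMetricOn g U) (hx : x ∈ U) (l k a b : Fin n) :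
    curvMat g a b x l k + curvMat g b k x l a + curvMat g k a x l b = 0 := by
  have hs : ∀ c a e i, matPd c (christoffelMat g a) x e i = matPd c (christoffelMat g i) x e a :=
    fun c a e i => pd_congr hg.isOpen hx (fun y hy => hg.christoffelMat_symm hy a e i) c
  have hm : ∀ c a i, (christoffelMat g c x * christoffelMat g a x) l i
      = (christoffelMat g c x * christoffelMat g i x) l a := fun c a i => by
    simp only [Matrix.mul_apply]
    exact Finset.sum_congr rfl fun m _ => by rw [hg.christoffelMat_symm hx a]
  simp only [curvMat_eq, Matrix.add_apply, Matrix.sub_apply]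
  rw [hs a b l k, hs b k l a, hs k a l b, hm a b k, hm b k a, hm k a b]
  ring

theorem metric_mul_endoCovAlong (hg : IsSmoothMetricOn g U) {F : MetricMat n}
    (hF : MatSmoothOn U F) (hx : x ∈ U) (c : Fin n) :
    g x * endoCovAlong g c F x = matPd c (fun y => g y * F y) x
      - ((christoffelMat g c x)ᵀ * (g x * F x) + g x * F x * christoffelMat g c x) := by
  rw [matPd_mul hg.isOpen hg.smooth hF hx, hg.matPd_metric hx, endoCovAlong]
  noncomm_ring

theorem endoCovAlong_curvMat (g : MetricMat n) (c a b : Fin n) (x : Fin n → ℝ) :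
    endoCovAlong g c (curvMat g a b) x = nablaCurvMat g c a b x
      + (∑ e, christoffelMat g c x e a • curvMat g e b x
        + ∑ e, christoffelMat g c x e b • curvMat g a e x) := by
  rw [nablaCurvMat, sub_add_cancel]

theorem nablaR_one_apply (g : MetricMat n) (x : Fin n → ℝ) (c l k a b : Fin n) :
    nablaR g 1 x ![c, l, k, a, b] = pd c (fun y => riemann g y ![l, k, a, b]) x
      - (∑ e, christoffelMat g c x e l * riemann g x ![e, k, a, b]
        + (∑ e, christoffelMat g c x e k * riemann g x ![l, e, a, b]
        + (∑ e, christoffelMat g c x e a * riemann g x ![l, k, e, b]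
        + (∑ e, christoffelMat g c x e b * riemann g x ![l, k, a, e])))) := by
  have h := covDeriv_cons g (riemann g) x c ![l, k, a, b]
  refine h.trans ?_
  rw [covAlong, Pi.sub_apply]
  congr 1
  simp only [tensorAct_apply, Fin.sum_univ_four]
  simp only [← add_assoc]
  rfl

theorem riemann_apply (g : MetricMat n) (x : Fin n → ℝ) (l k a b : Fin n) :
    riemann g x ![l, k, a, b] = (g x * curvMat g a b x) l k := rfl

theorem metric_mul_nablaCurvMat (hg : IsSmoothMetricOn g U) (hx : x ∈ U) (c a b l k : Fin n) :
    (g x * nablaCurvMat g c a b x) l k = nablaR g 1 x ![c, l, k, a, b] := by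
  rw [nablaR_one_apply, nablaCurvMat, Matrix.mul_sub,
    hg.metric_mul_endoCovAlong (hg.smooth_curvMat a b) hx, Matrix.mul_add, Matrix.mul_sum,
    Matrix.mul_sum]
  simp only [riemann_apply, Matrix.sub_apply, Matrix.add_apply, Matrix.sum_apply, Matrix.mul_smul,
    Matrix.smul_apply, smul_eq_mul, matPd_apply]
  rw [Matrix.mul_apply (M := (christoffelMat g c x)ᵀ),
    Matrix.mul_apply (M := g x * curvMat g a b x)]
  simp only [Matrix.transpose_apply, mul_comm _ (christoffelMat g c x _ k)]
  ring

end IsSmoothMetricOn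

end CovariantCalculus

section SecondOrderSymmetric

variable {n : ℕ} {g : MetricMat n} {U : Set (Fin n → ℝ)} {x : Fin n → ℝ}

namespace IsSmoothMetricOn

theorem smooth_endoCovAlong (hg : IsSmoothMetricOn g U) {F : MetricMat n} (hF : MatSmoothOn U F)
    (c : Fin n) : MatSmoothOn U (endoCovAlong g c F) :=
  ((hF.matPd hg.isOpen c).add ((hg.smooth_christoffelMat c).mul hF)).sub
    (hF.mul (hg.smooth_christoffelMat c))

theorem smooth_nablaCurvMat (hg : IsSmoothMetricOn g U) (c a b : Fin n) :
    MatSmoothOn U (nablaCurvMat g c a b) := by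
  refine (hg.smooth_endoCovAlong (hg.smooth_curvMat a b) c).sub (MatSmoothOn.add ?_ ?_)
  all_goals
    intro i j
    simp only [Matrix.sum_apply, Matrix.smul_apply, smul_eq_mul]
    exact SmoothOn.sum fun e _ => (hg.smooth_christoffelMat c _ _).mul (hg.smooth_curvMat _ _ i j)

theorem riemann_antisymm_left (hg : IsSmoothMetricOn g U) (hx : x ∈ U) (l k a b : Fin n) :
    riemann g x ![l, k, a, b] = -riemann g x ![k, l, a, b] :=
  congrFun (congrFun (hg.metric_mul_curvMat_skew hx a b) k) l

theorem riemann_antisymm_right (g : MetricMat n) (x : Fin n → ℝ) (l k a b : Fin n) :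
    riemann g x ![l, k, a, b] = -riemann g x ![l, k, b, a] := by
  rw [riemann_apply, riemann_apply, curvMat_antisymm g a b, Matrix.mul_neg, Matrix.neg_apply]

theorem riemann_cyclic (hg : IsSmoothMetricOn g U) (hx : x ∈ U) (l k a b : Fin n) :
    riemann g x ![l, k, a, b] + riemann g x ![l, a, b, k] + riemann g x ![l, b, k, a] = 0 := by
  simp only [riemann_apply, Matrix.mul_apply, ← Finset.sum_add_distrib, ← mul_add]
  exact Finset.sum_eq_zero fun m _ => by rw [hg.curvMat_cyclic hx, mul_zero]

theorem nablaR_one_antisymm_left (hg : IsSmoothMetricOn g U) (hx : x ∈ U) (c l k a b : Fin n) :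
    nablaR g 1 x ![c, l, k, a, b] = -nablaR g 1 x ![c, k, l, a, b] := by
  rw [nablaR_one_apply, nablaR_one_apply,
    pd_congr hg.isOpen hx (fun y hy => hg.riemann_antisymm_left hy l k a b), pd_neg]
  simp only [hg.riemann_antisymm_left hx l, hg.riemann_antisymm_left hx _ k, mul_neg,
    Finset.sum_neg_distrib]
  ring

theorem nablaR_one_antisymm_right (hg : IsSmoothMetricOn g U) (hx : x ∈ U) (c l k a b : Fin n) :
    nablaR g 1 x ![c, l, k, a, b] = -nablaR g 1 x ![c, l, k, b, a] := by
  rw [nablaR_one_apply, nablaR_one_apply,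
    pd_congr hg.isOpen hx (fun y _ => riemann_antisymm_right g y l k a b), pd_neg]
  simp only [riemann_antisymm_right g x _ _ a, riemann_antisymm_right g x _ _ _ b, mul_neg,
    Finset.sum_neg_distrib]
  ring

theorem nablaR_one_cyclic (hg : IsSmoothMetricOn g U) (hx : x ∈ U) (c l k a b : Fin n) :
    nablaR g 1 x ![c, l, k, a, b] + nablaR g 1 x ![c, l, a, b, k]
      + nablaR g 1 x ![c, l, b, k, a] = 0 := by
  have hd : ∀ I, DifferentiableAt ℝ (fun y => riemann g y I) x := fun I =>
    (hg.smooth_riemann I).differentiableAt hg.isOpen hx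
  have h0 := pd_eq_zero hg.isOpen hx (fun y hy => hg.riemann_cyclic hy l k a b) c
  rw [pd_add ((hd _).fun_add (hd _)) (hd _), pd_add (hd _) (hd _)] at h0
  have hs : ∀ (p : Fin n) (q r s : Fin n → Fin 4 → Fin n),
      (∀ e, riemann g x (q e) + riemann g x (r e) + riemann g x (s e) = 0) →
      ∑ e, christoffelMat g c x e p * riemann g x (q e)
        + ∑ e, christoffelMat g c x e p * riemann g x (r e)
        + ∑ e, christoffelMat g c x e p * riemann g x (s e) = 0 := fun p q r s h => by
    simp only [← Finset.sum_add_distrib, ← mul_add, h, mul_zero, Finset.sum_const_zero]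
  simp only [nablaR_one_apply]
  linarith [hs l _ _ _ fun e => hg.riemann_cyclic hx e k a b,
    hs k _ _ _ fun e => hg.riemann_cyclic hx l e a b,
    hs a _ _ _ fun e => hg.riemann_cyclic hx l k e b,
    hs b _ _ _ fun e => hg.riemann_cyclic hx l k a e]

theorem endoCovAlong_curvMat_cyclic (hg : IsSmoothMetricOn g U) (hx : x ∈ U) (c a b : Fin n) :
    endoCovAlong g c (curvMat g a b) x + endoCovAlong g a (curvMat g b c) x
      + endoCovAlong g b (curvMat g c a) x = 0 := by
  have hΓ := hg.smooth_christoffelMat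
  have key : ∀ c a b, matPd c (curvMat g a b) x
      = matPd c (matPd a (christoffelMat g b)) x - matPd c (matPd b (christoffelMat g a)) x
        + (matPd c (christoffelMat g a) x * christoffelMat g b x
          + christoffelMat g a x * matPd c (christoffelMat g b) x)
        - (matPd c (christoffelMat g b) x * christoffelMat g a x
          + christoffelMat g b x * matPd c (christoffelMat g a) x) := by
    intro c a b
    have h1 : MatSmoothOn U (matPd a (christoffelMat g b)) := (hΓ b).matPd hg.isOpen a
    have h2 : MatSmoothOn U (matPd b (christoffelMat g a)) := (hΓ a).matPd hg.isOpen b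
    rw [matPd_congr hg.isOpen hx (fun y _ => curvMat_eq g a b y),
      matPd_sub hg.isOpen ((h1.sub h2).add ((hΓ a).mul (hΓ b))) ((hΓ b).mul (hΓ a)) hx,
      matPd_add hg.isOpen (h1.sub h2) ((hΓ a).mul (hΓ b)) hx, matPd_sub hg.isOpen h1 h2 hx,
      matPd_mul hg.isOpen (hΓ a) (hΓ b) hx, matPd_mul hg.isOpen (hΓ b) (hΓ a) hx]
  simp only [endoCovAlong, key, curvMat_eq]
  rw [matPd_comm hg.isOpen (hΓ b) hx c a, matPd_comm hg.isOpen (hΓ a) hx c b,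
    matPd_comm hg.isOpen (hΓ c) hx a b]
  noncomm_ring

theorem nablaCurvMat_cyclic (hg : IsSmoothMetricOn g U) (hx : x ∈ U) (c a b : Fin n) :
    nablaCurvMat g c a b x + nablaCurvMat g a b c x + nablaCurvMat g b c a x = 0 := by
  have h := hg.endoCovAlong_curvMat_cyclic hx c a b
  have hs : ∀ c a b, ∑ e, christoffelMat g c x e a • curvMat g e b x
      = -∑ e, christoffelMat g a x e c • curvMat g b e x := fun c a b => by
    rw [← Finset.sum_neg_distrib]
    refine Finset.sum_congr rfl fun e _ => ?_
    rw [hg.christoffelMat_symm hx, curvMat_antisymm, smul_neg]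
  simp only [nablaCurvMat]
  rw [hs c a b, hs a b c, hs b c a, ← h]
  abel

theorem nablaR_one_cyclic_deriv (hg : IsSmoothMetricOn g U) (hx : x ∈ U) (c l k a b : Fin n) :
    nablaR g 1 x ![c, l, k, a, b] + nablaR g 1 x ![a, l, k, b, c]
      + nablaR g 1 x ![b, l, k, c, a] = 0 := by
  rw [← hg.metric_mul_nablaCurvMat hx, ← hg.metric_mul_nablaCurvMat hx,
    ← hg.metric_mul_nablaCurvMat hx, ← Matrix.add_apply, ← Matrix.add_apply, ← Matrix.mul_add,
    ← Matrix.mul_add, hg.nablaCurvMat_cyclic hx, Matrix.mul_zero, Matrix.zero_apply]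

end IsSmoothMetricOn

theorem covAlong_nablaR_one_of_symmetric (h2 : RthSymmetricOn g U 2) (hx : x ∈ U) (c : Fin n) :
    covAlong g c (nablaR g 1) x = 0 := by
  funext I
  exact h2 x hx (Fin.cons c I)

theorem covAlong_covAlong_riemann_of_symmetric (h2 : RthSymmetricOn g U 2) (hx : x ∈ U)
    (a b : Fin n) : covAlong g a (covAlong g b (riemann g)) x
      = ∑ e, christoffelMat g a x e b • covAlong g e (riemann g) x := by
  funext I
  have h := congrFun (covAlong_nablaR_one_of_symmetric h2 hx a) (Fin.cons b I)
  have h' := tensorAct_cons (christoffelMat g a x) (nablaR g 1 x) b I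
  rw [covAlong, Pi.sub_apply, Pi.zero_apply, sub_eq_zero] at h
  rw [← h] at h'
  rw [Finset.sum_apply, covAlong, Pi.sub_apply, sub_eq_iff_eq_add]
  exact h'

theorem pd_nablaR_one_of_symmetric (h2 : RthSymmetricOn g U 2) (hx : x ∈ U)
    (d c l k a b : Fin n) : pd d (fun y => nablaR g 1 y ![c, l, k, a, b]) x
      = ∑ e, christoffelMat g d x e c * nablaR g 1 x ![e, l, k, a, b]
        + (∑ e, christoffelMat g d x e l * nablaR g 1 x ![c, e, k, a, b]
        + (∑ e, christoffelMat g d x e k * nablaR g 1 x ![c, l, e, a, b]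
        + (∑ e, christoffelMat g d x e a * nablaR g 1 x ![c, l, k, e, b]
        + (∑ e, christoffelMat g d x e b * nablaR g 1 x ![c, l, k, a, e])))) := by
  have h := congrFun (covAlong_nablaR_one_of_symmetric h2 hx d) ![c, l, k, a, b]
  rw [covAlong, Pi.sub_apply, Pi.zero_apply, sub_eq_zero] at h
  refine h.trans ?_
  have hs : ∀ f : Fin 5 → ℝ, ∑ i, f i = f 0 + (f 1 + (f 2 + (f 3 + f 4))) := fun f => by
    rw [Fin.sum_univ_five]
    ring
  have h5 : ∀ S : (Fin 5 → Fin n) → ℝ,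
      tensorAct n 5 (christoffelMat g d x) S ![c, l, k, a, b]
      = ∑ e, christoffelMat g d x e c * S ![e, l, k, a, b]
        + (∑ e, christoffelMat g d x e l * S ![c, e, k, a, b]
        + (∑ e, christoffelMat g d x e k * S ![c, l, e, a, b]
        + (∑ e, christoffelMat g d x e a * S ![c, l, k, e, b]
        + (∑ e, christoffelMat g d x e b * S ![c, l, k, a, e])))) := by
    intro S
    rw [tensorAct_apply, hs]
    have hu : ∀ e, Function.update ![c, l, k, a, b] 0 e = ![e, l, k, a, b]
        ∧ Function.update ![c, l, k, a, b] 1 e = ![c, e, k, a, b]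
        ∧ Function.update ![c, l, k, a, b] 2 e = ![c, l, e, a, b]
        ∧ Function.update ![c, l, k, a, b] 3 e = ![c, l, k, e, b]
        ∧ Function.update ![c, l, k, a, b] 4 e = ![c, l, k, a, e] := by
      intro e
      refine ⟨?_, ?_, ?_, ?_, ?_⟩ <;> funext i <;> fin_cases i <;> rfl
    simp only [hu]
    rfl
  exact h5 _

namespace IsSmoothMetricOn

theorem endoCovAlong_nablaCurvMat_of_symmetric (hg : IsSmoothMetricOn g U)
    (h2 : RthSymmetricOn g U 2) (hx : x ∈ U) (d c a b : Fin n) :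
    endoCovAlong g d (nablaCurvMat g c a b) x
      = ∑ e, christoffelMat g d x e c • nablaCurvMat g e a b x
        + (∑ e, christoffelMat g d x e a • nablaCurvMat g c e b x
        + ∑ e, christoffelMat g d x e b • nablaCurvMat g c a e x) := by
  have hcancel : ∀ X Y : Matrix (Fin n) (Fin n) ℝ, g x * X = g x * Y → X = Y := fun X Y h => by
    rw [← Matrix.one_mul X, ← Matrix.nonsing_inv_mul _ (hg.nondeg x hx), Matrix.mul_assoc, h,
      ← Matrix.mul_assoc, Matrix.nonsing_inv_mul _ (hg.nondeg x hx), Matrix.one_mul]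
  apply hcancel
  rw [hg.metric_mul_endoCovAlong (hg.smooth_nablaCurvMat c a b) hx, Matrix.mul_add, Matrix.mul_add]
  simp only [Matrix.mul_sum, Matrix.mul_smul]
  ext l k
  have hp : matPd d (fun y => g y * nablaCurvMat g c a b y) x l k
      = pd d (fun y => nablaR g 1 y ![c, l, k, a, b]) x :=
    pd_congr hg.isOpen hx (fun y hy => hg.metric_mul_nablaCurvMat hy c a b l k) d
  simp only [Matrix.sub_apply, Matrix.add_apply, Matrix.sum_apply, Matrix.smul_apply, smul_eq_mul]
  rw [hp, pd_nablaR_one_of_symmetric h2 hx, Matrix.mul_apply (M := (christoffelMat g d x)ᵀ),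
    Matrix.mul_apply (M := g x * nablaCurvMat g c a b x)]
  simp only [hg.metric_mul_nablaCurvMat hx, Matrix.transpose_apply,
    mul_comm _ (christoffelMat g d x _ k)]
  ring

theorem tensorAct_curvMat_nablaR_one (hg : IsSmoothMetricOn g U) (h2 : RthSymmetricOn g U 2)
    (hx : x ∈ U) (a b : Fin n) : tensorAct n 5 (curvMat g a b x) (nablaR g 1 x) = 0 := by
  have h := hg.covAlong_covAlong_sub (hg.smooth_nablaR 1) hx a b
  rw [covAlong_eq_zero hg.isOpen hx fun y hy => covAlong_nablaR_one_of_symmetric h2 hy b,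
    covAlong_eq_zero hg.isOpen hx fun y hy => covAlong_nablaR_one_of_symmetric h2 hy a, sub_zero,
    zero_eq_neg] at h
  exact h

theorem tensorAct_curvMat_riemann (hg : IsSmoothMetricOn g U) (h2 : RthSymmetricOn g U 2)
    (hx : x ∈ U) (a b : Fin n) : tensorAct n 4 (curvMat g a b x) (riemann g x) = 0 := by
  have h := hg.covAlong_covAlong_sub hg.smooth_riemann hx a b
  rw [covAlong_covAlong_riemann_of_symmetric h2 hx, covAlong_covAlong_riemann_of_symmetric h2 hx,
    Finset.sum_congr rfl fun e _ => by rw [hg.christoffelMat_symm hx a e b], sub_self,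
    zero_eq_neg] at h
  exact h

theorem tensorAct_nablaCurvMat_nablaR_one (hg : IsSmoothMetricOn g U)
    (h2 : RthSymmetricOn g U 2) (hx : x ∈ U) (c a b : Fin n) :
    tensorAct n 5 (nablaCurvMat g c a b x) (nablaR g 1 x) = 0 := by
  have h := covAlong_tensorAct (g := g) hg.isOpen (hg.smooth_curvMat a b) (hg.smooth_nablaR 1) hx c
  rw [covAlong_eq_zero hg.isOpen hx fun y hy => hg.tensorAct_curvMat_nablaR_one h2 hy a b,
    covAlong_nablaR_one_of_symmetric h2 hx, map_zero, add_zero] at h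
  simp only [nablaCurvMat, map_sub, map_add, map_sum, map_smul, LinearMap.sub_apply,
    LinearMap.add_apply, LinearMap.sum_apply, LinearMap.smul_apply, ← h,
    hg.tensorAct_curvMat_nablaR_one h2 hx, smul_zero, Finset.sum_const_zero, add_zero, sub_zero]

theorem tensorAct_nablaCurvMat_riemann (hg : IsSmoothMetricOn g U)
    (h2 : RthSymmetricOn g U 2) (hx : x ∈ U) (c a b : Fin n) :
    tensorAct n 4 (nablaCurvMat g c a b x) (riemann g x)
      + tensorAct n 4 (curvMat g a b x) (covAlong g c (riemann g) x) = 0 := by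
  have h := covAlong_tensorAct (g := g) hg.isOpen (hg.smooth_curvMat a b) hg.smooth_riemann hx c
  rw [covAlong_eq_zero hg.isOpen hx fun y hy => hg.tensorAct_curvMat_riemann h2 hy a b] at h
  rw [h]
  simp only [nablaCurvMat, map_sub, map_add, map_sum, map_smul, LinearMap.sub_apply,
    LinearMap.add_apply, LinearMap.sum_apply, LinearMap.smul_apply,
    hg.tensorAct_curvMat_riemann h2 hx, smul_zero, Finset.sum_const_zero, add_zero, sub_zero]

theorem tensorAct_nablaCurvMat_covAlong_riemann (hg : IsSmoothMetricOn g U)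
    (h2 : RthSymmetricOn g U 2) (hx : x ∈ U) (c d a b : Fin n) :
    tensorAct n 4 (nablaCurvMat g c a b x) (covAlong g d (riemann g) x)
      + tensorAct n 4 (nablaCurvMat g d a b x) (covAlong g c (riemann g) x) = 0 := by
  have hT := hg.smooth_covAlong hg.smooth_riemann c
  have h := covAlong_add (g := g) hg.isOpen
    (TensorSmoothOn.tensorAct (hg.smooth_nablaCurvMat c a b) hg.smooth_riemann)
    (TensorSmoothOn.tensorAct (hg.smooth_curvMat a b) hT) hx d
  rw [covAlong_eq_zero hg.isOpen hx fun y hy => hg.tensorAct_nablaCurvMat_riemann h2 hy c a b,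
    covAlong_tensorAct hg.isOpen (hg.smooth_nablaCurvMat c a b) hg.smooth_riemann hx,
    covAlong_tensorAct hg.isOpen (hg.smooth_curvMat a b) hT hx,
    hg.endoCovAlong_nablaCurvMat_of_symmetric h2 hx, endoCovAlong_curvMat,
    covAlong_covAlong_riemann_of_symmetric h2 hx] at h
  have hs : ∀ (p : Fin n) (M F : Fin n → Matrix (Fin n) (Fin n) ℝ)
      (S : Fin n → (Fin 4 → Fin n) → ℝ),
      (∀ e, tensorAct n 4 (M e) (riemann g x) + tensorAct n 4 (F e) (S e) = 0) →
      ∑ e, christoffelMat g d x e p • tensorAct n 4 (M e) (riemann g x)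
        + ∑ e, christoffelMat g d x e p • tensorAct n 4 (F e) (S e) = 0 := fun p M F S h => by
    simp only [← Finset.sum_add_distrib, ← smul_add, h, smul_zero, Finset.sum_const_zero]
  have hc := hs c _ _ _ fun e => hg.tensorAct_nablaCurvMat_riemann h2 hx e a b
  have ha := hs a _ _ _ fun e => hg.tensorAct_nablaCurvMat_riemann h2 hx c e b
  have hb := hs b _ _ _ fun e => hg.tensorAct_nablaCurvMat_riemann h2 hx c a e
  simp only [map_add, map_sum, map_smul, LinearMap.add_apply, LinearMap.sum_apply,
    LinearMap.smul_apply] at h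
  linear_combination -h - hc - ha - hb

end IsSmoothMetricOn

/-- A second-order symmetric Riemannian metric is locally symmetric. -/
theorem IsSmoothMetricOn.nablaR_one_eq_zero (hg : IsSmoothMetricOn g U)
    (hpos : ∀ y ∈ U, (g y).PosDef) (h2 : RthSymmetricOn g U 2) : RthSymmetricOn g U 1 := by
  intro x hx idx
  exact congrFun (eq_zero_of_semisymmetric (hpos x hx) (nablaR g 1 x)
    (fun c a b => nablaCurvMat g c a b x)
    (fun c a b l k => hg.metric_mul_nablaCurvMat hx c a b l k)
    (fun c l k a b => hg.nablaR_one_antisymm_left hx c l k a b)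
    (fun c l k a b => hg.nablaR_one_antisymm_right hx c l k a b)
    (fun c l k a b => hg.nablaR_one_cyclic hx c l k a b)
    (fun c l k a b => hg.nablaR_one_cyclic_deriv hx c l k a b)
    (fun c a b => hg.tensorAct_nablaCurvMat_nablaR_one h2 hx c a b)
    (fun c d a b => hg.tensorAct_nablaCurvMat_covAlong_riemann h2 hx c d a b)) idx

end SecondOrderSymmetric

section NullTranslation

variable {d : ℕ} {f : (Fin (d + 2) → ℝ) → ℝ} {x : Fin (d + 2) → ℝ}

theorem update_one_eq_add (x : Fin (d + 2) → ℝ) (t : ℝ) :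
    Function.update x 1 t = x + Pi.single 1 (t - x 1) := by
  funext i
  by_cases h : i = 1
  · subst h
    simp
  · simp [h]

theorem vIndep.pd_one (hf : vIndep f) : pd 1 f x = 0 := by
  by_cases hd : DifferentiableAt ℝ f x
  · have hl := hd.hasFDerivAt.hasLineDerivAt (Pi.single 1 1)
    have hc : (fun t : ℝ => f (x + t • Pi.single 1 1)) = fun _ => f x := by
      funext t
      have := hf x (x 1 + t)
      rw [update_one_eq_add] at this
      rw [← this]
      congr 2
      rw [← Pi.single_smul]
      simp
    rw [HasLineDerivAt, hc] at hl
    exact hl.unique (hasDerivAt_const 0 (f x))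
  · simp [pd, fderiv_zero_of_not_differentiableAt hd]

theorem vIndep.pd (hf : vIndep f) (i : Fin (d + 2)) : vIndep (pd i f) := by
  intro x t
  have h : (fun y => f (y + Pi.single 1 (t - x 1))) = f := by
    funext y
    have := hf y (y 1 + (t - x 1))
    rw [update_one_eq_add, add_sub_cancel_left] at this
    exact this
  rw [update_one_eq_add, _root_.pd, ← fderiv_comp_add_right, h, _root_.pd]

theorem vIndep.christoffel {B : MetricMat (d + 2)} (hB : vIndep B) (k i j : Fin (d + 2)) :
    vIndep (fun x => christoffel B x k i j) := by
  have he : ∀ a b, vIndep (fun x => B x a b) := fun a b x t =>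
    congrFun (congrFun (hB x t) a) b
  intro x t
  simp only [_root_.christoffel]
  rw [hB x t]
  refine congrArg _ (Finset.sum_congr rfl fun l _ => ?_)
  rw [(he l j).pd i x t, (he l i).pd j x t, (he i j).pd l x t]

theorem vIndep.riemann {B : MetricMat (d + 2)} (hB : vIndep B) (I : Fin 4 → Fin (d + 2)) :
    vIndep (fun x => riemann B x I) := by
  intro x t
  simp only [_root_.riemann, curvUp]
  refine Finset.sum_congr rfl fun l _ => ?_
  have hΓ : ∀ k i j, _root_.christoffel B (Function.update x 1 t) k i j
    = _root_.christoffel B x k i j := fun k i j => hB.christoffel k i j x t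
  simp only [hΓ]
  rw [hB x t, (hB.christoffel _ _ _).pd _ x t, (hB.christoffel _ _ _).pd _ x t]

theorem vIndep.covDeriv {s : ℕ} {B : MetricMat (d + 2)} (hB : vIndep B)
    {T : TensorField (d + 2) s} (hT : ∀ I, vIndep (fun x => T x I))
    (I : Fin (s + 1) → Fin (d + 2)) : vIndep (fun x => covDeriv B T x I) := by
  intro x t
  have hΓ : ∀ k i j, _root_.christoffel B (Function.update x 1 t) k i j
    = _root_.christoffel B x k i j := fun k i j => hB.christoffel k i j x t
  have hT' : ∀ J, T (Function.update x 1 t) J = T x J := fun J => hT J x t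
  simp only [_root_.covDeriv, hΓ, hT']
  rw [(hT _).pd _ x t]

theorem vIndep.nablaR {B : MetricMat (d + 2)} (hB : vIndep B) :
    ∀ (r : ℕ) (I : Fin (4 + r) → Fin (d + 2)), vIndep (fun x => nablaR B r x I)
  | 0, I => hB.riemann I
  | r + 1, I => hB.covDeriv (hB.nablaR r) I

end NullTranslation

section Leaves

variable {d : ℕ} {u v : ℝ}

theorem sum_univ_add_two {M : Type*} [AddCommMonoid M] (f : Fin (d + 2) → M) :
    ∑ m, f m = f 0 + (f 1 + ∑ i : Fin d, f i.succ.succ) := by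
  rw [Fin.sum_univ_succ, Fin.sum_univ_succ]
  rfl

theorem one_ne_succ_succ (i : Fin d) : (1 : Fin (d + 2)) ≠ i.succ.succ := by
  simp [Fin.ext_iff]

theorem contDiff_emb {m : WithTop ℕ∞} : ContDiff ℝ m (emb d u v) := by
  refine contDiff_pi.2 fun i => ?_
  refine Fin.cases ?_ (fun i => Fin.cases ?_ (fun i => ?_) i) i
  · exact contDiff_const
  · exact contDiff_const
  · exact contDiff_apply ℝ ℝ i

theorem pd_comp_emb {f : (Fin (d + 2) → ℝ) → ℝ} {y : Fin d → ℝ}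
    (hf : DifferentiableAt ℝ f (emb d u v y)) (i : Fin d) :
    pd i (fun z => f (emb d u v z)) y = pd i.succ.succ f (emb d u v y) := by
  let L : (Fin d → ℝ) →L[ℝ] (Fin (d + 2) → ℝ) :=
    ContinuousLinearMap.pi (Fin.cons 0 (Fin.cons 0 fun j => ContinuousLinearMap.proj j))
  have hL : HasFDerivAt (emb d u v) L y := by
    refine hasFDerivAt_pi.2 fun i => ?_
    refine Fin.cases ?_ (fun i => Fin.cases ?_ (fun i => ?_) i) i
    · exact hasFDerivAt_const u y
    · exact hasFDerivAt_const v y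
    · exact hasFDerivAt_apply i y
  have hi : L (Pi.single i 1) = Pi.single i.succ.succ 1 := by
    funext j
    refine Fin.cases ?_ (fun j => Fin.cases ?_ (fun j => ?_) j) j
    · simp [L]
    · simp [L, Fin.ext_iff]
    · simp [L, Pi.single_apply]
  have h := (hf.hasFDerivAt.comp y hL).fderiv
  simp only [pd]
  rw [show (fun z => f (emb d u v z)) = f ∘ emb d u v from rfl, h,
    ContinuousLinearMap.comp_apply, hi]

/-- A smooth metric in Brinkmann form with `v`-independent coefficients and spatial block `gs`. -/
structure IsBrinkmannOn (B : MetricMat (d + 2))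
    (gs : (Fin (d + 2) → ℝ) → Matrix (Fin d) (Fin d) ℝ) (U : Set (Fin (d + 2) → ℝ)) : Prop where
  metric : IsSmoothMetricOn B U
  indep : vIndep B
  row : ∀ x l, B x 1 l = if l = 0 then -1 else 0
  col : ∀ x k, B x k 1 = if k = 0 then -1 else 0
  spatial : ∀ x i j, B x i.succ.succ j.succ.succ = gs x i j

namespace IsBrinkmannOn

variable {B : MetricMat (d + 2)} {gs : (Fin (d + 2) → ℝ) → Matrix (Fin d) (Fin d) ℝ}
  {U : Set (Fin (d + 2) → ℝ)} {x : Fin (d + 2) → ℝ}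

theorem inv_zero_row (hB : IsBrinkmannOn B gs U) (hx : x ∈ U) (l : Fin (d + 2)) :
    (B x)⁻¹ 0 l = if l = 1 then -1 else 0 := by
  have h := congrFun (congrFun (Matrix.mul_nonsing_inv _ (hB.metric.nondeg x hx)) 1) l
  simp only [Matrix.mul_apply, hB.row, ite_mul, neg_mul, one_mul, zero_mul, Finset.sum_ite_eq',
    Finset.mem_univ, if_true, Matrix.one_apply] at h
  rw [← neg_neg ((B x)⁻¹ 0 l), h]
  by_cases hl : l = 1
  · simp [hl]
  · simp [hl, Ne.symm hl]

theorem inv_zero_col (hB : IsBrinkmannOn B gs U) (hx : x ∈ U) (k : Fin (d + 2)) :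
    (B x)⁻¹ k 0 = if k = 1 then -1 else 0 := by
  rw [← hB.inv_zero_row hx k]
  have h := Matrix.transpose_nonsing_inv (B x)
  rw [(hB.metric.symm x hx).eq] at h
  exact congrFun (congrFun h 0) k

theorem inv_spatial (hB : IsBrinkmannOn B gs U) (hx : x ∈ U) (i j : Fin d) :
    (B x)⁻¹ i.succ.succ j.succ.succ = (gs x)⁻¹ i j := by
  have h1 : (Matrix.of fun i j : Fin d => (B x)⁻¹ i.succ.succ j.succ.succ) * gs x = 1 := by
    ext i j
    have h := congrFun (congrFun (Matrix.nonsing_inv_mul _ (hB.metric.nondeg x hx))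
      i.succ.succ) j.succ.succ
    rw [Matrix.mul_apply, sum_univ_add_two, hB.inv_zero_col hx, hB.row] at h
    simp only [hB.spatial] at h
    rw [Matrix.mul_apply]
    simpa [Fin.ext_iff, Matrix.one_apply] using h
  rw [Matrix.inv_eq_left_inv h1]
  rfl

theorem pd_entry_one (hB : IsBrinkmannOn B gs U) (k l : Fin (d + 2)) :
    pd 1 (fun y => B y k l) x = 0 :=
  vIndep.pd_one fun y t => by rw [hB.indep y t]

theorem pd_row (hB : IsBrinkmannOn B gs U) (a l : Fin (d + 2)) :
    pd a (fun y => B y 1 l) x = 0 := by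
  simp only [hB.row, pd_const]

theorem pd_col (hB : IsBrinkmannOn B gs U) (a k : Fin (d + 2)) :
    pd a (fun y => B y k 1) x = 0 := by
  simp only [hB.col, pd_const]

theorem christoffel_zero (hB : IsBrinkmannOn B gs U) (hx : x ∈ U) (i j : Fin (d + 2)) :
    christoffel B x 0 i j = 0 := by
  simp [christoffel, hB.inv_zero_row hx, hB.pd_entry_one, hB.pd_row]

theorem christoffel_one_left (hB : IsBrinkmannOn B gs U) (k j : Fin (d + 2)) :
    christoffel B x k 1 j = 0 := by
  simp [christoffel, hB.pd_entry_one, hB.pd_row, hB.pd_col]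

theorem christoffel_one_right (hB : IsBrinkmannOn B gs U) (k i : Fin (d + 2)) :
    christoffel B x k i 1 = 0 := by
  simp [christoffel, hB.pd_entry_one, hB.pd_col]

theorem curvUp_zero (hB : IsBrinkmannOn B gs U) (hx : x ∈ U) (k i j : Fin (d + 2)) :
    curvUp B x 0 k i j = 0 := by
  have h : ∀ a i j, pd a (fun y => christoffel B y 0 i j) x = 0 := fun a i j =>
    pd_eq_zero hB.metric.isOpen hx (fun y hy => hB.christoffel_zero hy i j) a
  simp [curvUp, h, hB.christoffel_zero hx]

theorem riemann_null (hB : IsBrinkmannOn B gs U) (hx : x ∈ U) (I : Fin 4 → Fin (d + 2))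
    (a : Fin 4) (ha : I a = 1) : riemann B x I = 0 := by
  have h1 : ∀ k i j, pd 1 (fun y => christoffel B y k i j) x = 0 := fun k i j =>
    (hB.indep.christoffel k i j).pd_one
  match a with
  | 0 => simp [riemann, ha, hB.row, hB.curvUp_zero hx]
  | 1 => simp [riemann, ha, curvUp, hB.christoffel_one_right, pd_const]
  | 2 => simp [riemann, ha, curvUp, h1, hB.christoffel_one_left, pd_const]
  | 3 => simp [riemann, ha, curvUp, h1, hB.christoffel_one_left, pd_const]

theorem covDeriv_null {s : ℕ} (hB : IsBrinkmannOn B gs U) {T : TensorField (d + 2) s}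
    (hT : ∀ I, vIndep (fun x => T x I))
    (hT0 : ∀ x ∈ U, ∀ I a, I a = 1 → T x I = 0) (hx : x ∈ U) (I : Fin (s + 1) → Fin (d + 2))
    (a : Fin (s + 1)) (ha : I a = 1) : covDeriv B T x I = 0 := by
  induction a using Fin.cases with
  | zero => simp [covDeriv, ha, (hT _).pd_one, hB.christoffel_one_left]
  | succ a =>
    rw [covDeriv, pd_eq_zero hB.metric.isOpen hx (fun y hy => hT0 y hy _ a ha), zero_sub,
      neg_eq_zero]
    refine Finset.sum_eq_zero fun b _ => Finset.sum_eq_zero fun e _ => ?_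
    by_cases hab : a = b
    · subst hab
      rw [ha, hB.christoffel_one_right, zero_mul]
    · rw [hT0 x hx _ a (by rw [Function.update_of_ne hab, ha]), mul_zero]

theorem nablaR_null (hB : IsBrinkmannOn B gs U) :
    ∀ (r : ℕ), ∀ x ∈ U, ∀ (I : Fin (4 + r) → Fin (d + 2)) (a : Fin (4 + r)), I a = 1 →
      nablaR B r x I = 0
  | 0 => fun _ hx I a ha => hB.riemann_null hx I a ha
  | r + 1 => fun _ hx I a ha =>
    hB.covDeriv_null (hB.indep.nablaR r) (hB.nablaR_null r) hx I a ha

theorem isOpen_leaf (hB : IsBrinkmannOn B gs U) : IsOpen {y | emb d u v y ∈ U} :=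
  hB.metric.isOpen.preimage (contDiff_emb (m := 0)).continuous

theorem isSmoothMetricOn_leaf (hB : IsBrinkmannOn B gs U)
    (hpos : ∀ x ∈ U, (gs x).PosDef) :
    IsSmoothMetricOn (fun y => gs (emb d u v y)) {y | emb d u v y ∈ U} where
  isOpen := hB.isOpen_leaf
  smooth i j := by
    simp only [← hB.spatial]
    exact (hB.metric.smooth i.succ.succ j.succ.succ).comp contDiff_emb.contDiffOn fun y hy => hy
  symm y hy := by
    have h := (hpos _ hy).isHermitian
    rwa [Matrix.IsHermitian, Matrix.conjTranspose_eq_transpose_of_trivial] at h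
  nondeg y hy := (Matrix.isUnit_iff_isUnit_det _).mp (hpos _ hy).isUnit

theorem christoffel_leaf (hB : IsBrinkmannOn B gs U) {y : Fin d → ℝ} (hy : emb d u v y ∈ U)
    (k i j : Fin d) : christoffel B (emb d u v y) k.succ.succ i.succ.succ j.succ.succ
      = christoffel (fun z => gs (emb d u v z)) y k i j := by
  have hp : ∀ a i j : Fin d, pd a (fun z => gs (emb d u v z) i j) y
      = pd a.succ.succ (fun x => B x i.succ.succ j.succ.succ) (emb d u v y) := fun a i j => by
    rw [← pd_comp_emb ((hB.metric.smooth _ _).differentiableAt hB.metric.isOpen hy)]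
    simp only [hB.spatial]
  rw [christoffel, christoffel, sum_univ_add_two, hB.inv_zero_col hy, hB.pd_row, hB.pd_row,
    hB.pd_entry_one]
  simp [Fin.ext_iff, hp, hB.inv_spatial hy]

theorem pd_leaf (hB : IsBrinkmannOn B gs U) {y : Fin d → ℝ} (hy : emb d u v y ∈ U)
    {f : (Fin (d + 2) → ℝ) → ℝ} {h : (Fin d → ℝ) → ℝ} (hf : SmoothOn U f)
    (hfh : ∀ z, emb d u v z ∈ U → f (emb d u v z) = h z) (i : Fin d) :
    pd i.succ.succ f (emb d u v y) = pd i h y := by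
  rw [← pd_comp_emb (hf.differentiableAt hB.metric.isOpen hy)]
  exact pd_congr hB.isOpen_leaf hy hfh i

theorem curvUp_leaf (hB : IsBrinkmannOn B gs U) {y : Fin d → ℝ} (hy : emb d u v y ∈ U)
    (l k i j : Fin d) :
    curvUp B (emb d u v y) l.succ.succ k.succ.succ i.succ.succ j.succ.succ
      = curvUp (fun z => gs (emb d u v z)) y l k i j := by
  have hp : ∀ a k i j : Fin d,
      pd a.succ.succ (fun x => christoffel B x k.succ.succ i.succ.succ j.succ.succ) (emb d u v y)
      = pd a (fun z => christoffel (fun z => gs (emb d u v z)) z k i j) y := fun a k i j =>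
    hB.pd_leaf hy (hB.metric.smooth_christoffelMat _ _ _)
      (fun z hz => hB.christoffel_leaf hz k i j) a
  simp only [curvUp, hp, sum_univ_add_two, hB.christoffel_zero hy, hB.christoffel_one_right,
    hB.christoffel_leaf hy, mul_zero, zero_mul, zero_add]

theorem riemann_leaf (hB : IsBrinkmannOn B gs U) {y : Fin d → ℝ} (hy : emb d u v y ∈ U)
    (I : Fin 4 → Fin d) : riemann B (emb d u v y) (fun a => (I a).succ.succ)
      = riemann (fun z => gs (emb d u v z)) y I := by
  simp only [riemann, sum_univ_add_two, hB.curvUp_zero hy, hB.col, hB.curvUp_leaf hy, hB.spatial]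
  simp [Fin.ext_iff]

theorem covDeriv_leaf {s : ℕ} (hB : IsBrinkmannOn B gs U) {T : TensorField (d + 2) s}
    {T' : TensorField d s} (hT : TensorSmoothOn U T)
    (hT0 : ∀ x ∈ U, ∀ I a, I a = 1 → T x I = 0)
    (hTT' : ∀ y, emb d u v y ∈ U → ∀ I : Fin s → Fin d,
      T (emb d u v y) (fun a => (I a).succ.succ) = T' y I)
    {y : Fin d → ℝ} (hy : emb d u v y ∈ U) (I : Fin (s + 1) → Fin d) :
    covDeriv B T (emb d u v y) (fun a => (I a).succ.succ)
      = covDeriv (fun z => gs (emb d u v z)) T' y I := by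
  rw [covDeriv, covDeriv, hB.pd_leaf hy (hT _) fun z hz => hTT' z hz fun a => I a.succ]
  congr 1
  refine Finset.sum_congr rfl fun a _ => ?_
  rw [sum_univ_add_two, hB.christoffel_zero hy, hT0 _ hy _ a (Function.update_self ..), zero_mul,
    mul_zero, zero_add, zero_add]
  refine Finset.sum_congr rfl fun e _ => ?_
  rw [hB.christoffel_leaf hy, ← hTT' y hy]
  congr 2
  funext b
  by_cases hb : b = a
  · subst hb
    simp
  · simp [hb]

theorem nablaR_leaf (hB : IsBrinkmannOn B gs U) :
    ∀ (r : ℕ) (y : Fin d → ℝ), emb d u v y ∈ U → ∀ I : Fin (4 + r) → Fin d,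
      nablaR B r (emb d u v y) (fun a => (I a).succ.succ)
        = nablaR (fun z => gs (emb d u v z)) r y I
  | 0 => fun _ hy I => hB.riemann_leaf hy I
  | r + 1 => fun _ hy I => hB.covDeriv_leaf (hB.metric.smooth_nablaR r) (hB.nablaR_null r)
    (hB.nablaR_leaf r) hy I

end IsBrinkmannOn

theorem IsLorentzMat.isUnit_det {n : ℕ} {A : Matrix (Fin n) (Fin n) ℝ} (hA : IsLorentzMat A) :
    IsUnit A.det := by
  obtain ⟨P, -, h⟩ := hA
  have hdet := congrArg Matrix.det h
  rw [Matrix.det_mul, Matrix.det_mul, Matrix.det_diagonal] at hdet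
  rw [isUnit_iff_ne_zero]
  intro h0
  rw [h0, mul_zero, zero_mul] at hdet
  refine Finset.prod_ne_zero_iff.mpr (fun i _ => ?_) hdet.symm
  split_ifs <;> norm_num

theorem isBrinkmannOn_brinkmannMat {U : Set (Fin (d + 2) → ℝ)} (hU : IsOpen U)
    {H : (Fin (d + 2) → ℝ) → ℝ} {W : Fin d → (Fin (d + 2) → ℝ) → ℝ}
    {gs : (Fin (d + 2) → ℝ) → Matrix (Fin d) (Fin d) ℝ}
    (hHv : vIndep H) (hWv : ∀ i, vIndep (W i)) (hgsv : vIndep gs)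
    (hHs : SmoothOn U H) (hWs : ∀ i, SmoothOn U (W i))
    (hgss : ∀ i j, SmoothOn U (fun x => gs x i j)) (hgsym : ∀ x ∈ U, (gs x).IsSymm)
    (hlor : ∀ x ∈ U, IsLorentzMat (brinkmannMat d H W gs x)) :
    IsBrinkmannOn (brinkmannMat d H W gs) gs U where
  metric :=
    { isOpen := hU
      smooth := fun k l => by
        have hite : ∀ (p : Prop) [Decidable p] (f : (Fin (d + 2) → ℝ) → ℝ), SmoothOn U f →
            SmoothOn U (fun x => if p then f x else 0) := fun p _ f hf => by
          split_ifs
          exacts [hf, contDiffOn_const]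
        refine ((((hite _ _ (contDiffOn_const.mul hHs)).add (hite _ _ contDiffOn_const)).add
          (hite _ _ ?_)).add (hite _ _ ?_)).add ?_
        · exact SmoothOn.sum fun i _ => hite _ _ (hWs i).neg
        · exact SmoothOn.sum fun i _ => hite _ _ (hWs i).neg
        · exact SmoothOn.sum fun i _ => SmoothOn.sum fun j _ => hite _ _ (hgss i j)
      symm := fun x hx => by
        ext k l
        simp only [Matrix.transpose_apply, brinkmannMat]
        have h1 : ∑ i : Fin d, ∑ j : Fin d,
            (if l = i.succ.succ ∧ k = j.succ.succ then gs x i j else 0)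
            = ∑ i : Fin d, ∑ j : Fin d,
              (if k = i.succ.succ ∧ l = j.succ.succ then gs x i j else 0) := by
          rw [Finset.sum_comm]
          refine Finset.sum_congr rfl fun i _ => Finset.sum_congr rfl fun j _ => ?_
          rw [(hgsym x hx).apply i j]
          exact if_congr and_comm rfl rfl
        rw [h1, if_congr (and_comm (a := l = 0) (b := k = 0)) rfl rfl,
          if_congr (show (l = 0 ∧ k = 1) ∨ (l = 1 ∧ k = 0) ↔ (k = 0 ∧ l = 1) ∨ (k = 1 ∧ l = 0)
            by tauto) rfl rfl]
        ring
      nondeg := fun x hx => (hlor x hx).isUnit_det }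
  indep := fun x t => by
    have hW : ∀ i, W i (Function.update x 1 t) = W i x := fun i => hWv i x t
    funext k l
    simp only [brinkmannMat, hHv x t, hW, hgsv x t]
  row := fun x l => by simp [brinkmannMat, one_ne_succ_succ]
  col := fun x k => by simp [brinkmannMat, one_ne_succ_succ]
  spatial := fun x i j => by
    simp [brinkmannMat, (one_ne_succ_succ _).symm, Fin.succ_inj, ite_and, Finset.sum_ite_eq]

end Leaves

/-!
## STATEMENT 2
For a second-order symmetric Brinkmann spacetime written in a Brinkmann chart
`ds² = -2du(dv + H du + Wᵢ dxⁱ) + g_{ij} dxⁱdxʲ` (all data independent of `v`),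
every leaf `{u = const, v = const}` with the induced metric `g_{ij}(u,·)` is a
locally symmetric Riemannian manifold.
-/
theorem brinkmann_second_symmetric_leaves_locally_symmetric
    {d : ℕ} (U : Set (Fin (d + 2) → ℝ)) (hU : IsOpen U)
    (H : (Fin (d + 2) → ℝ) → ℝ) (W : Fin d → (Fin (d + 2) → ℝ) → ℝ)
    (gs : (Fin (d + 2) → ℝ) → Matrix (Fin d) (Fin d) ℝ)
    (hHv : vIndep H) (hWv : ∀ i, vIndep (W i)) (hgsv : vIndep gs)
    (hHs : ContDiffOn ℝ (⊤ : ℕ∞) H U)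
    (hWs : ∀ i, ContDiffOn ℝ (⊤ : ℕ∞) (W i) U)
    (hgss : ∀ i j, ContDiffOn ℝ (⊤ : ℕ∞) (fun x => gs x i j) U)
    (hgsym : ∀ x ∈ U, (gs x).IsSymm) (hgpos : ∀ x ∈ U, (gs x).PosDef)
    (hlor : ∀ x ∈ U, IsLorentzMat (brinkmannMat d H W gs x))
    (h2sym : RthSymmetricOn (brinkmannMat d H W gs) U 2) :
    ∀ x₀ ∈ U,
      (∀ y ∈ {y : Fin d → ℝ | emb d (x₀ 0) (x₀ 1) y ∈ U},
        (gs (emb d (x₀ 0) (x₀ 1) y)).PosDef) ∧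
      RthSymmetricOn (fun y => gs (emb d (x₀ 0) (x₀ 1) y))
        {y : Fin d → ℝ | emb d (x₀ 0) (x₀ 1) y ∈ U} 1 := by
  intro x₀ _
  have hB := isBrinkmannOn_brinkmannMat hU hHv hWv hgsv hHs hWs hgss hgsym hlor
  refine ⟨fun y hy => hgpos _ hy,
    (hB.isSmoothMetricOn_leaf hgpos).nablaR_one_eq_zero (fun y hy => hgpos _ hy)
      fun y hy I => ?_⟩
  rw [← hB.nablaR_leaf 2 y hy]
  exact h2sym _ hy _
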